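/- RM constants for Bochner L^p tuples: Let n ≥ 3, let (X₁,…,X_{n+1}) be reflexive Banach spaces, ϖ₀ : X₁×⋯×X_{n+1} → ℂ an (n+1)-linear contraction, (Ω,μ) a measure space, p₁,…,p_{n+1} ∈ (1,∞) with ∑_m 1/p_m = 1, and ϖ(f₁,…,f_{n+1}) := ∫_Ω ϖ₀(f₁(ω),…,f_{n+1}(ω)) dμ(ω) on ∏_m L^{p_m}(Ω;X_m), which is an (n+1)-linear contraction. Let J ⊂ {1,…,n+1} with 1 ≤ #J ≤ n−2, v ∉ J, and set 1/p(J) = ∑_{j∈J} 1/p_j. Then for any functions f_{j,k} ∈ L^{p_j}(Ω;X_j) (j ∈ J, k ∈ ℕ): ‖{(f_{j,k})_{j∈J}}_{k=1}^∞‖_{RM_v(ϖ,J)} is comparable, with constants depending only on n and the exponents, to ‖ ω ↦ ‖{(f_{j,k}(ω))_{j∈J}}_{k=1}^∞‖_{RM_v(ϖ₀,J)} ‖_{L^{p(J)}(Ω)}. -/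

import Mathlib

open MeasureTheory
open scoped ENNReal NNReal BigOperators Classical

noncomputable section

namespace OVM

/-! ### Points and cubes in `ℝ^d` -/

abbrev Pt (d : ℕ) := Fin d → ℝ

structure Cube (d : ℕ) where
  x : Fin d → ℝ
  s : ℝ
  pos : 0 < s

namespace Cube

variable {d : ℕ}

def set (Q : Cube d) : Set (Pt d) := {p | ∀ i, Q.x i ≤ p i ∧ p i < Q.x i + Q.s}

def vol (Q : Cube d) : ℝ := Q.s ^ d

def center (Q : Cube d) : Pt d := fun i => Q.x i + Q.s / 2

/-- The concentric dilate `CQ` with `C = 2√d + 1 ≥ 2√d`. -/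
def dil (Q : Cube d) : Cube d :=
  ⟨fun i => Q.x i + Q.s / 2 - (2 * Real.sqrt d + 1) * Q.s / 2,
   (2 * Real.sqrt d + 1) * Q.s, by
     have h1 : (0:ℝ) < 2 * Real.sqrt d + 1 := by positivity
     exact mul_pos h1 Q.pos⟩

end Cube

/-! ### Dyadic grids: `D_ω = {2^{-k}([0,1)^d + m) + ∑_{2^{-j} < 2^{-k}} ω_j 2^{-j}}` -/

def dyadicShiftVec {d : ℕ} (ω : ℤ → Fin d → Bool) (k : ℤ) : Pt d :=
  fun i => ∑' j : ℤ, if k < j ∧ ω j i = true then (2:ℝ) ^ (-j) else 0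

def dyadicCube {d : ℕ} (ω : ℤ → Fin d → Bool) (k : ℤ) (m : Fin d → ℤ) : Cube d :=
  ⟨fun i => (m i : ℝ) * (2:ℝ) ^ (-k) + dyadicShiftVec ω k i, (2:ℝ) ^ (-k), by positivity⟩

def dyadicGrid {d : ℕ} (ω : ℤ → Fin d → Bool) : Set (Cube d) :=
  {Q | ∃ k m, Q = dyadicCube ω k m}

def IsDyadicGrid {d : ℕ} (D : Set (Cube d)) : Prop := ∃ ω, D = dyadicGrid ω

def stdGrid (d : ℕ) : Set (Cube d) := dyadicGrid fun _ _ => false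

/-- `IsAncestor K Q k` means `Q^{(k)} = K`, i.e. `K` is the `k`-th dyadic ancestor of `Q`. -/
def IsAncestor {d : ℕ} (K Q : Cube d) (k : ℕ) : Prop :=
  Q.set ⊆ K.set ∧ K.s = 2 ^ k * Q.s

/-- `Q'` is a dyadic child of `Q`. -/
def IsChild {d : ℕ} (Q' Q : Cube d) : Prop := IsAncestor Q Q' 1

/-! ### Haar functions -/

def haar1 (a s : ℝ) (b : Bool) : ℝ → ℝ := fun t =>
  if b then
    (if a ≤ t ∧ t < a + s / 2 then (Real.sqrt s)⁻¹
     else if a + s / 2 ≤ t ∧ t < a + s then -(Real.sqrt s)⁻¹ else 0)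
  else if a ≤ t ∧ t < a + s then (Real.sqrt s)⁻¹ else 0

/-- The Haar function `h_Q^η` on the cube `Q`. -/
def haar {d : ℕ} (Q : Cube d) (η : Fin d → Bool) : Pt d → ℝ :=
  fun p => ∏ i, haar1 (Q.x i) Q.s (η i) (p i)

/-- A Haar parameter is cancellative iff it is not identically zero. -/
def cancel {d : ℕ} (η : Fin d → Bool) : Prop := ∃ i, η i = true

/-! ### basic function classes, averages, sparse collections -/

/-- bounded, compactly supported, strongly measurable (the class `L^∞_c`). -/
def BCS {d : ℕ} {X : Type*} [NormedAddCommGroup X] (f : Pt d → X) : Prop :=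
  StronglyMeasurable f ∧ (∃ M, ∀ x, ‖f x‖ ≤ M) ∧ HasCompactSupport f

/-- the average `⟨f⟩_Q`. -/
def cubeAvg {d : ℕ} {X : Type*} [NormedAddCommGroup X] [NormedSpace ℝ X]
    (Q : Cube d) (f : Pt d → X) : X :=
  Q.vol⁻¹ • ∫ y in Q.set, f y

/-- the average `⟨‖f‖_X⟩_Q`, as an extended real. -/
def avgNormE {d : ℕ} {X : Type*} [NormedAddCommGroup X] (Q : Cube d) (f : Pt d → X) : ℝ≥0∞ :=
  (∫⁻ y in Q.set, ENNReal.ofReal ‖f y‖) / ENNReal.ofReal Q.vol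

/-- `S` is an `η`-sparse collection of cubes of `D`. -/
def IsSparseIn {d : ℕ} (η : ℝ) (S D : Set (Cube d)) : Prop :=
  S ⊆ D ∧ ∃ E : Cube d → Set (Pt d),
    (∀ Q ∈ S, E Q ⊆ Q.set ∧ ENNReal.ofReal (η * Q.vol) < volume (E Q)) ∧
    S.PairwiseDisjoint E

/-- `L^p`-norm of an `ℝ≥0∞`-valued function (`0 < p < ∞`). -/
def lpNormE {d : ℕ} (F : Pt d → ℝ≥0∞) (p : ℝ) : ℝ≥0∞ := (∫⁻ x, F x ^ p) ^ p⁻¹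

/-- distance between two sets. -/
def setDist {α : Type*} [PseudoEMetricSpace α] (A B : Set α) : ℝ :=
  (⨅ (x ∈ A) (y ∈ B), edist x y).toReal

/-! ### randomized norms -/

/-- `‖(e_k)‖_{Rad(X)} = (E‖∑ ε_k e_k‖²)^{1/2}`. -/
def radNorm {X : Type*} [NormedAddCommGroup X] {K : ℕ} (e : Fin K → X) : ℝ :=
  Real.sqrt ((∑ ε : Fin K → Bool, ‖∑ k, if ε k then e k else -e k‖ ^ 2) / 2 ^ K)

/-- `‖(e_{l,m})‖_{Rad₂(X)}`, doubly indexed random sums. -/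
def rad2Norm {X : Type*} [NormedAddCommGroup X] {N M : ℕ} (e : Fin N → Fin M → X) : ℝ :=
  Real.sqrt ((∑ ε : Fin N → Fin M → Bool, ‖∑ l, ∑ m, if ε l m then e l m else -e l m‖ ^ 2) /
    2 ^ (N * M))

/-- `(E E'‖∑ ε_i ε'_j e_{i,j}‖²)^{1/2}`, two independent families of signs. -/
def radRad {X : Type*} [NormedAddCommGroup X] {N : ℕ} (e : Fin N → Fin N → X) : ℝ :=
  Real.sqrt ((∑ ε : Fin N → Bool, ∑ δ : Fin N → Bool,
      ‖∑ i, ∑ j, if ε i = δ j then e i j else -e i j‖ ^ 2) / 4 ^ N)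

/-- Pisier's property `(α)`. -/
def HasPisierAlpha (X : Type*) [NormedAddCommGroup X] [NormedSpace ℝ X] : Prop :=
  ∃ C : ℝ, ∀ (N : ℕ) (a : Fin N → Fin N → ℝ) (e : Fin N → Fin N → X),
    (∀ i j, |a i j| ≤ 1) → radRad (fun i j => a i j • e i j) ≤ C * radRad e

/-! ### multilinear contractions and RM constants -/

section RM

variable {n : ℕ} {Z : Fin (n + 1) → Type*} [∀ j, NormedAddCommGroup (Z j)]

/-- `ϖ` is an `(n+1)`-linear contraction. -/
def IsContraction [∀ j, NormedSpace ℂ (Z j)] (ϖ : (∀ j, Z j) → ℂ) : Prop :=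
  (∃ Λ : MultilinearMap ℂ Z ℂ, ⇑Λ = ϖ) ∧ ∀ e, ‖ϖ e‖ ≤ ∏ j, ‖e j‖

/-- The `RM_v(ϖ, J)` constant of a finite indexed family `{(e_{j,k})_{j∈J}}_{k=1}^K`:
the supremum of `|∑_k ϖ(e_{1,k},…,e_{n+1,k})|` over all completions of the family with a
fixed unit vector in the slot `v` and Rademacher-normalized sequences elsewhere. -/
def RMfam (ϖ : (∀ j, Z j) → ℂ) (J : Finset (Fin (n + 1))) (v : Fin (n + 1))
    {K : ℕ} (e : ∀ j ∈ J, Fin K → Z j) : ℝ≥0∞ :=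
  ⨆ (g : ∀ j, Fin K → Z j) (_ :
      (∀ j (hj : j ∈ J), g j = e j hj) ∧
      (∃ gv : Z v, (∀ k, g v k = gv) ∧ ‖gv‖ ≤ 1) ∧
      ∀ j, j ∉ J → j ≠ v → radNorm (g j) ≤ 1),
    ENNReal.ofReal ‖∑ k, ϖ fun j => g j k‖

/-- The `RM_v(ϖ, J)` constant of a set `A` of `J`-tuples. -/
def RMconst (ϖ : (∀ j, Z j) → ℂ) (J : Finset (Fin (n + 1))) (v : Fin (n + 1))
    (A : Set (∀ j ∈ J, Z j)) : ℝ≥0∞ :=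
  ⨆ (K : ℕ) (e : ∀ j ∈ J, Fin K → Z j)
    (_ : ∀ k : Fin K, (fun j hj => e j hj k) ∈ A), RMfam ϖ J v e

/-- The `RM'_v(ϖ, J)` constant: as `RMconst`, but with pairwise distinct tuples. -/
def RMconstDistinct (ϖ : (∀ j, Z j) → ℂ) (J : Finset (Fin (n + 1))) (v : Fin (n + 1))
    (A : Set (∀ j ∈ J, Z j)) : ℝ≥0∞ :=
  ⨆ (K : ℕ) (e : ∀ j ∈ J, Fin K → Z j)
    (_ : (∀ k : Fin K, (fun j hj => e j hj k) ∈ A) ∧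
         Function.Injective fun k : Fin K => (fun j hj => e j hj k : ∀ j ∈ J, Z j)),
    RMfam ϖ J v e

/-- The `RM_v(ϖ, J)` constant of a family indexed by `ℕ` (sup of its finite truncations). -/
def RMfamInf (ϖ : (∀ j, Z j) → ℂ) (J : Finset (Fin (n + 1))) (v : Fin (n + 1))
    (e : ∀ j ∈ J, ℕ → Z j) : ℝ≥0∞ :=
  ⨆ K : ℕ, RMfam ϖ J v fun j hj => fun k : Fin K => e j hj k

/-- The factor appearing in the `R_ϖ`-boundedness condition; for `J = ∅` (the case `n = 2`)
no RM factor appears. -/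
def RMfactor (ϖ : (∀ j, Z j) → ℂ) (J : Finset (Fin (n + 1))) (v : Fin (n + 1))
    {K : ℕ} (e : ∀ j ∈ J, Fin K → Z j) : ℝ≥0∞ :=
  if J = ∅ then 1 else RMfam ϖ J v e

/-! ### the Rademacher maximal function and the RMF property -/

variable [∀ j, NormedSpace ℂ (Z j)]

/-- The multilinear Rademacher maximal function `RM_{D,ϖ,J,v}[(f_j)_{j∈J}]`. -/
def RMmax {d : ℕ} (ϖ : (∀ j, Z j) → ℂ) (D : Set (Cube d)) (J : Finset (Fin (n + 1)))
    (v : Fin (n + 1)) (f : ∀ j ∈ J, Pt d → Z j) (x : Pt d) : ℝ≥0∞ :=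
  RMconst ϖ J v {a | ∃ Q ∈ D, x ∈ Q.set ∧ a = fun j hj => cubeAvg Q (f j hj)}

/-- The `RMF_ϖ` property of the tuple `(Z_1, …, Z_{n+1})` relative to the lattice `D`
and the exponents `p`. -/
def HasRMF {d : ℕ} (ϖ : (∀ j, Z j) → ℂ) (D : Set (Cube d)) (p : Fin (n + 1) → ℝ≥0∞) : Prop :=
  ∀ j₁ j₂ : Fin (n + 1), j₁ ≠ j₂ → ∃ v : Fin (n + 1), v ≠ j₁ ∧ v ≠ j₂ ∧
    ∀ J : Finset (Fin (n + 1)), J.Nonempty → (∀ j ∈ J, j ≠ j₁ ∧ j ≠ j₂ ∧ j ≠ v) →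
      ∃ C : ℝ≥0∞, C ≠ ⊤ ∧ ∀ f : ∀ j ∈ J, Pt d → Z j,
        lpNormE (RMmax ϖ D J v f) ((∑ j ∈ J, (p j)⁻¹)⁻¹).toReal ≤
          C * ∏ j ∈ J.attach, eLpNorm (f j.1 j.2) (p j.1) volume

end RM


/-! ### Kahane's inequality -/

lemma two_point_aux (t : ℝ) (h0 : 0 ≤ t) (h1 : t ≤ 1) (m : ℕ) :
    0 ≤ ((1 + t) ^ m - (1 - t) ^ m) / 2 ∧ ((1 + t) ^ m - (1 - t) ^ m) / 2 ≤ 2 ^ m * t ∧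
      ((1 + t) ^ m + (1 - t) ^ m) / 2 ≤ 1 + 2 ^ m * t ^ 2 := by
  induction m with
  | zero => simp; exact ⟨h0, sq_nonneg t⟩
  | succ m ih =>
    obtain ⟨a, b, c⟩ := ih
    have h2 : (1 + t) ^ m ≤ 2 ^ m := pow_le_pow_left₀ (by linarith) (by linarith) m
    have h3 : 0 ≤ (1 - t) ^ m := pow_nonneg (by linarith) m
    have h4 : 0 ≤ (1 + t) ^ m := pow_nonneg (by linarith) m
    refine ⟨?_, ?_, ?_⟩
    · rw [pow_succ, pow_succ]; nlinarith
    · rw [pow_succ, pow_succ, pow_succ]; nlinarith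
    · rw [pow_succ, pow_succ, pow_succ]; nlinarith

lemma two_point_pos (a b : ℝ) (hb : 0 ≤ b) (hab : b ≤ a) (m : ℕ) (hm : 1 ≤ m) :
    ((a + (2:ℝ)⁻¹ ^ m * b) ^ (2 * m) + (a - (2:ℝ)⁻¹ ^ m * b) ^ (2 * m)) / 2 ≤
      (a ^ 2 + b ^ 2) ^ m := by
  rcases (hb.trans hab).eq_or_lt with h | ha
  · have : b = 0 := by linarith
    subst this; subst h
    have : m ≠ 0 := by omega
    simp [this]
  set t := b / a with ht
  have hb' : b = a * t := by rw [ht]; field_simp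
  have ht0 : 0 ≤ t := by positivity
  have ht1 : t ≤ 1 := by rw [ht, div_le_one ha]; exact hab
  have hs : (2:ℝ)⁻¹ ^ m ≤ 1 := pow_le_one₀ (by norm_num) (by norm_num)
  have hs0 : 0 ≤ (2:ℝ)⁻¹ ^ m := by positivity
  have key := (two_point_aux ((2:ℝ)⁻¹ ^ m * t) (by positivity) (by nlinarith) (2 * m)).2.2
  have e1 : (2:ℝ) ^ (2 * m) * ((2:ℝ)⁻¹ ^ m * t) ^ 2 = t ^ 2 := by
    rw [mul_pow, ← pow_mul, mul_comm m 2, ← mul_assoc, ← mul_pow]; norm_num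
  rw [e1] at key
  have hB : 1 + t ^ 2 ≤ (1 + t ^ 2) ^ m := le_self_pow₀ (by nlinarith) (by omega)
  have e2 : ((a + (2:ℝ)⁻¹ ^ m * b) ^ (2 * m) + (a - (2:ℝ)⁻¹ ^ m * b) ^ (2 * m)) / 2 =
      a ^ (2 * m) * (((1 + (2:ℝ)⁻¹ ^ m * t) ^ (2 * m) + (1 - (2:ℝ)⁻¹ ^ m * t) ^ (2 * m)) / 2) := by
    rw [← mul_div_assoc, mul_add, ← mul_pow, ← mul_pow, hb']; ring_nf
  have e3 : (a ^ 2 + b ^ 2) ^ m = a ^ (2 * m) * (1 + t ^ 2) ^ m := by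
    rw [pow_mul, ← mul_pow, hb']; ring_nf
  rw [e2, e3]
  exact mul_le_mul_of_nonneg_left (key.trans hB) (by positivity)

lemma two_point_vec {X : Type*} [NormedAddCommGroup X] [NormedSpace ℝ X] (x y : X)
    (m : ℕ) (hm : 1 ≤ m) :
    (‖x + (2:ℝ)⁻¹ ^ m • y‖ ^ (2 * m) + ‖x - (2:ℝ)⁻¹ ^ m • y‖ ^ (2 * m)) / 2 ≤
      ((‖x + y‖ ^ 2 + ‖x - y‖ ^ 2) / 2) ^ m := by
  wlog h : ‖x - y‖ ≤ ‖x + y‖ generalizing y with H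
  · have := H (-y) (by simpa [sub_eq_add_neg] using (not_le.1 h).le)
    simpa [sub_eq_add_neg, add_comm] using this
  set s := (2:ℝ)⁻¹ ^ m with hs'
  have hs : s ≤ 1 := pow_le_one₀ (by norm_num) (by norm_num)
  have hs0 : 0 ≤ s := by positivity
  set a := (‖x + y‖ + ‖x - y‖) / 2 with ha
  set b := (‖x + y‖ - ‖x - y‖) / 2 with hb
  have h1 : ‖x + s • y‖ ≤ a + s * b := by
    have e : x + s • y = ((1 + s) / 2) • (x + y) + ((1 - s) / 2) • (x - y) := by module
    rw [e]
    refine (norm_add_le _ _).trans ?_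
    rw [norm_smul, norm_smul, Real.norm_of_nonneg (by linarith), Real.norm_of_nonneg (by linarith)]
    rw [ha, hb]; apply le_of_eq; ring
  have h2 : ‖x - s • y‖ ≤ a - s * b := by
    have e : x - s • y = ((1 - s) / 2) • (x + y) + ((1 + s) / 2) • (x - y) := by module
    rw [e]
    refine (norm_add_le _ _).trans ?_
    rw [norm_smul, norm_smul, Real.norm_of_nonneg (by linarith), Real.norm_of_nonneg (by linarith)]
    rw [ha, hb]; apply le_of_eq; ring
  have h3 := two_point_pos a b (by rw [hb]; linarith) (by rw [ha, hb]; linarith [norm_nonneg (x-y)]) m hm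
  have e3 : a ^ 2 + b ^ 2 = (‖x + y‖ ^ 2 + ‖x - y‖ ^ 2) / 2 := by rw [ha, hb]; ring
  rw [e3] at h3
  refine le_trans ?_ h3
  gcongr

/-- signed sum -/
def ssum {X : Type*} [AddCommGroup X] {K : ℕ} (x : Fin K → X) (ε : Fin K → Bool) : X :=
  ∑ k, if ε k then x k else -x k

lemma ssum_cons {X : Type*} [AddCommGroup X] {K : ℕ} (x : Fin (K + 1) → X) (b : Bool)
    (ε : Fin K → Bool) :
    ssum x (Fin.cons b ε) = (if b then x 0 else - x 0) + ssum (fun k => x k.succ) ε := by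
  simp [ssum, Fin.sum_univ_succ]

lemma sum_bool_succ {K : ℕ} {M : Type*} [AddCommMonoid M] (F : (Fin (K + 1) → Bool) → M) :
    ∑ ε, F ε = ∑ ε : Fin K → Bool, (F (Fin.cons true ε) + F (Fin.cons false ε)) := by
  rw [← (Fin.consEquiv (fun _ : Fin (K+1) => Bool)).sum_comp, Fintype.sum_prod_type]
  simp [Finset.sum_add_distrib, Fin.consEquiv]

lemma hyper (m : ℕ) (hm : 1 ≤ m) : ∀ (K : ℕ) {X : Type u} [NormedAddCommGroup X]
    [NormedSpace ℝ X] (x0 : X) (x : Fin K → X),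
    (∑ ε, ‖x0 + (2:ℝ)⁻¹ ^ m • ssum x ε‖ ^ (2 * m)) / 2 ^ K ≤
      ((∑ ε, ‖x0 + ssum x ε‖ ^ 2) / 2 ^ K) ^ m := by
  intro K
  induction K with
  | zero => intro X _ _ x0 x; simp [ssum, pow_mul]
  | succ K ih =>
    intro X _ _ x0 x
    set s := (2:ℝ)⁻¹ ^ m with hs
    -- the space `X ⊕₂ X`
    let c : ℝ := Real.sqrt (1 / 2)
    have hc : c ^ 2 = 1 / 2 := Real.sq_sqrt (by norm_num)
    let y0 : WithLp 2 (X × X) := WithLp.toLp 2 (c • (x0 + x 0), c • (x0 - x 0))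
    let y : Fin K → WithLp 2 (X × X) := fun k => WithLp.toLp 2 (c • x k.succ, c • x k.succ)
    have hy : ∀ ε, ssum y ε =
        WithLp.toLp 2 (c • ssum (fun k => x k.succ) ε, c • ssum (fun k => x k.succ) ε) := by
      intro ε
      have : ∀ k, (if ε k then y k else - y k) = WithLp.toLp 2
        (c • (if ε k then x k.succ else -x k.succ), c • (if ε k then x k.succ else -x k.succ)) := by
        intro k; split_ifs <;> simp [y, ← WithLp.toLp_neg]
      simp only [ssum, this]
      rw [← WithLp.toLp_sum, Finset.smul_sum]
      congr 1
      ext <;> simp [Prod.fst_sum, Prod.snd_sum]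
    have hn : ∀ (r : ℝ) ε, ‖y0 + r • ssum y ε‖ ^ 2 =
        (‖(x0 + r • ssum (fun k => x k.succ) ε) + x 0‖ ^ 2 +
         ‖(x0 + r • ssum (fun k => x k.succ) ε) - x 0‖ ^ 2) / 2 := by
      intro r ε
      rw [WithLp.prod_norm_sq_eq_of_L2, hy]
      set S := ssum (fun k => x k.succ) ε
      have e1 : (y0 + r • WithLp.toLp 2 (c • S, c • S)).fst = c • ((x0 + r • S) + x 0) := by
        show c • (x0 + x 0) + r • (c • S) = _
        module
      have e2 : (y0 + r • WithLp.toLp 2 (c • S, c • S)).snd = c • ((x0 + r • S) - x 0) := by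
        show c • (x0 - x 0) + r • (c • S) = _
        module
      rw [e1, e2, norm_smul, norm_smul, mul_pow, mul_pow, Real.norm_eq_abs, sq_abs, hc]; ring
    have h := ih y0 y
    have hL : (∑ ε, ‖x0 + s • ssum x ε‖ ^ (2 * m)) / 2 ^ (K + 1) ≤
        (∑ ε, ‖y0 + s • ssum y ε‖ ^ (2 * m)) / 2 ^ K := by
      rw [sum_bool_succ, pow_succ (2:ℝ) K, mul_comm ((2:ℝ)^K) 2, ← div_div, Finset.sum_div _ _ (2:ℝ)]
      gcongr with ε
      rw [pow_mul ‖y0 + _‖, hn]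
      refine le_trans (le_of_eq ?_) (two_point_vec (x0 + s • ssum (fun k => x k.succ) ε) (x 0) m hm)
      simp only [ssum_cons, if_true, Bool.false_eq_true, if_false]
      set S := ssum (fun k => x k.succ) ε
      have e1 : x0 + s • (x 0 + S) = x0 + s • S + s • x 0 := by module
      have e2 : x0 + s • (-x 0 + S) = x0 + s • S - s • x 0 := by module
      rw [e1, e2]
    have hR : (∑ ε, ‖y0 + ssum y ε‖ ^ 2) / 2 ^ K = (∑ ε, ‖x0 + ssum x ε‖ ^ 2) / 2 ^ (K + 1) := by
      rw [sum_bool_succ, pow_succ (2:ℝ) K, mul_comm ((2:ℝ)^K) 2, ← div_div, Finset.sum_div _ _ (2:ℝ)]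
      congr 1
      refine Finset.sum_congr rfl fun ε _ => ?_
      have := hn 1 ε
      simp only [one_smul] at this
      rw [this]
      simp only [ssum_cons, if_true, Bool.false_eq_true, if_false]
      set S := ssum (fun k => x k.succ) ε
      have e1 : x0 + (x 0 + S) = x0 + S + x 0 := by module
      have e2 : x0 + (-x 0 + S) = x0 + S - x 0 := by module
      rw [e1, e2]
    rw [hR] at h
    exact hL.trans h

lemma kahane_even {X : Type*} [NormedAddCommGroup X] [NormedSpace ℝ X] (m : ℕ) (hm : 1 ≤ m)
    {K : ℕ} (x : Fin K → X) :
    (∑ ε, ‖ssum x ε‖ ^ (2 * m)) / 2 ^ K ≤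
      (2 ^ m) ^ (2 * m) * ((∑ ε, ‖ssum x ε‖ ^ 2) / 2 ^ K) ^ m := by
  have h := hyper m hm K 0 x
  simp only [zero_add, norm_smul, mul_pow, ← Finset.mul_sum] at h
  rw [mul_div_assoc] at h
  have e : (2 ^ m : ℝ) ^ (2 * m) * ‖((2:ℝ)⁻¹ ^ m)‖ ^ (2 * m) = 1 := by
    rw [← mul_pow, Real.norm_of_nonneg (by positivity), ← mul_pow]; norm_num
  calc _ = (2 ^ m : ℝ) ^ (2 * m) * (‖((2:ℝ)⁻¹ ^ m)‖ ^ (2 * m) * ((∑ ε, ‖ssum x ε‖ ^ (2 * m)) / 2 ^ K)) := by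
        rw [← mul_assoc, e, one_mul]
    _ ≤ _ := by gcongr

lemma radNorm_sq {X : Type*} [NormedAddCommGroup X] {K : ℕ} (x : Fin K → X) :
    radNorm x ^ 2 = (∑ ε, ‖ssum x ε‖ ^ 2) / 2 ^ K :=
  Real.sq_sqrt (by positivity)

lemma radNorm_nonneg {X : Type*} [NormedAddCommGroup X] {K : ℕ} (x : Fin K → X) :
    0 ≤ radNorm x := Real.sqrt_nonneg _

lemma kahane_one {X : Type*} [NormedAddCommGroup X] [NormedSpace ℝ X]
    {K : ℕ} (x : Fin K → X) :
    radNorm x ≤ 16 * ((∑ ε, ‖ssum x ε‖) / 2 ^ K) := by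
  have h4 := kahane_even 2 (by norm_num) x
  rw [← radNorm_sq] at h4
  set r := radNorm x
  have hr : 0 ≤ r := radNorm_nonneg x
  set a := (∑ ε, ‖ssum x ε‖) / 2 ^ K with ha
  set d := (∑ ε, ‖ssum x ε‖ ^ 3) / 2 ^ K with hd
  set q := (∑ ε, ‖ssum x ε‖ ^ (2*2)) / 2 ^ K with hq
  have ha0 : 0 ≤ a := by positivity
  have hd0 : 0 ≤ d := by positivity
  have hr2 : r ^ 2 = (∑ ε, ‖ssum x ε‖ ^ 2) / 2 ^ K := radNorm_sq x
  have c1 : (r ^ 2) ^ 2 ≤ a * d := by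
    rw [hr2, ha, hd, div_pow, div_mul_div_comm, ← sq ((2:ℝ)^K)]
    gcongr
    refine Finset.sum_sq_le_sum_mul_sum_of_sq_le_mul _ (fun _ _ => by positivity)
      (fun _ _ => by positivity) (fun _ _ => le_of_eq (by ring))
  have c2 : d ^ 2 ≤ r ^ 2 * q := by
    rw [hr2, hq, hd, div_pow, div_mul_div_comm, ← sq ((2:ℝ)^K)]
    gcongr
    refine Finset.sum_sq_le_sum_mul_sum_of_sq_le_mul _ (fun _ _ => by positivity)
      (fun _ _ => by positivity) (fun _ _ => le_of_eq (by ring))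
  rcases hr.eq_or_lt with h | h
  · rw [← h]; positivity
  have c3 : r ^ 8 ≤ a ^ 2 * d ^ 2 := by
    calc r ^ 8 = ((r ^ 2) ^ 2) ^ 2 := by ring
      _ ≤ (a * d) ^ 2 := by gcongr
      _ = _ := by ring
  have c4 : r ^ 8 ≤ a ^ 2 * (r ^ 2 * ((2 ^ 2) ^ (2 * 2) * (r ^ 2) ^ 2)) := by
    refine c3.trans ?_
    gcongr
    refine c2.trans ?_
    gcongr
  have c5 : r ^ 2 ≤ (16 * a) ^ 2 := by
    have : r ^ 6 * r ^ 2 ≤ r ^ 6 * (16 * a) ^ 2 := by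
      calc _ = r ^ 8 := by ring
        _ ≤ _ := c4
        _ = _ := by ring
    exact le_of_mul_le_mul_left this (by positivity)
  exact le_of_sq_le_sq c5 (by positivity)

lemma norm_le_radNorm {X : Type*} [NormedAddCommGroup X] [NormedSpace ℝ X]
    {K : ℕ} (x : Fin K → X) (k : Fin K) : ‖x k‖ ≤ radNorm x := by
  refine le_of_sq_le_sq ?_ (radNorm_nonneg x)
  rw [radNorm_sq, le_div_iff₀ (by positivity)]
  let T : (Fin K → Bool) ≃ (Fin K → Bool) :=
    Function.Involutive.toPerm (fun ε => Function.update ε k (!ε k)) (by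
      intro ε; ext i; by_cases h : i = k
      · subst h; simp
      · simp [h])
  have hTd : ∀ ε i, T ε i = if i = k then !ε k else ε i := by
    intro ε i
    show Function.update ε k (!ε k) i = _
    rw [Function.update_apply]
  have hT : ∀ ε, 2 * ‖x k‖ ^ 2 ≤ ‖ssum x ε‖ ^ 2 + ‖ssum x (T ε)‖ ^ 2 := by
    intro ε
    have h1 : ssum x ε - ssum x (T ε) = if ε k then (2:ℝ) • x k else -((2:ℝ) • x k) := by
      simp only [ssum, ← Finset.sum_sub_distrib]
      rw [Finset.sum_eq_single k]
      · rw [hTd]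
        cases ε k <;> simp <;> module
      · intro i _ hi
        simp [hTd, hi]
      · simp
    have h2 : ‖ssum x ε - ssum x (T ε)‖ = 2 * ‖x k‖ := by
      rw [h1]; split_ifs <;> simp [norm_smul]
    have h3 := norm_sub_le (ssum x ε) (ssum x (T ε))
    rw [h2] at h3
    nlinarith [sq_nonneg (‖ssum x ε‖ - ‖ssum x (T ε)‖), norm_nonneg (x k), norm_nonneg (ssum x ε), norm_nonneg (ssum x (T ε))]
  have h := Finset.sum_le_sum fun ε (_ : ε ∈ Finset.univ) => hT ε
  rw [Finset.sum_add_distrib, T.sum_comp (fun ε => ‖ssum x ε‖ ^ 2)] at h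
  simp at h
  linarith

/-- Kahane constant. -/
def kah (P : ℝ) : ℝ := 16 * 2 ^ ⌈P⌉₊

lemma one_le_kah (P : ℝ) : 1 ≤ kah P := by
  have : (1:ℝ) ≤ 2 ^ ⌈P⌉₊ := one_le_pow₀ (by norm_num)
  unfold kah; linarith

lemma jensen_unif {K : ℕ} (f : (Fin K → Bool) → ℝ) (hf : ∀ ε, 0 ≤ f ε) {q : ℝ} (hq : 1 ≤ q) :
    ((∑ ε, f ε) / 2 ^ K) ^ q ≤ (∑ ε, f ε ^ q) / 2 ^ K := by
  have := Real.rpow_arith_mean_le_arith_mean_rpow (Finset.univ : Finset (Fin K → Bool))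
    (fun _ => ((2:ℝ) ^ K)⁻¹) f (fun _ _ => by positivity) (by simp) (fun i _ => hf i) hq
  simpa [← Finset.mul_sum, div_eq_inv_mul] using this

lemma kah_up {X : Type*} [NormedAddCommGroup X] [NormedSpace ℝ X] {P : ℝ} (hP : 1 ≤ P)
    {K : ℕ} (x : Fin K → X) :
    (∑ ε, ‖ssum x ε‖ ^ P) / 2 ^ K ≤ kah P ^ P * radNorm x ^ P := by
  set m := ⌈P⌉₊ with hm
  have hPm : P ≤ m := Nat.le_ceil P
  have hm1 : 1 ≤ m := by exact_mod_cast (hP.trans hPm)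
  have hP0 : 0 < P := by linarith
  have hr := radNorm_nonneg x
  have hk := kahane_even m hm1 x
  rw [← radNorm_sq] at hk
  set M := (∑ ε, ‖ssum x ε‖ ^ P) / 2 ^ K with hM
  have hM0 : 0 ≤ M := by positivity
  have hq : 1 ≤ (2 * m : ℕ) / P := by
    rw [le_div_iff₀ hP0]; push_cast; linarith
  have h1 := jensen_unif (fun ε => ‖ssum x ε‖ ^ P) (fun _ => by positivity) hq
  have e1 : ∀ ε, (‖ssum x ε‖ ^ P) ^ (((2 * m : ℕ) : ℝ) / P) = ‖ssum x ε‖ ^ (2 * m) := by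
    intro ε
    rw [← Real.rpow_mul (norm_nonneg _), mul_div_cancel₀ _ hP0.ne', Real.rpow_natCast]
  simp only [e1] at h1
  have h2 : M ^ (((2 * m : ℕ) : ℝ) / P) ≤ (2 ^ m * radNorm x) ^ (2 * m) := by
    refine (h1.trans hk).trans (le_of_eq ?_)
    rw [← pow_mul (radNorm x), ← mul_pow]
  have h3 : M ≤ (2 ^ m * radNorm x) ^ P := by
    have := Real.rpow_le_rpow (by positivity) h2 (z := P / (2 * m : ℕ)) (by positivity)
    rw [← Real.rpow_mul hM0, div_mul_div_cancel₀ hP0.ne', div_self (by positivity), Real.rpow_one,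
      ← Real.rpow_natCast, ← Real.rpow_mul (by positivity), mul_div_cancel₀ _ (by positivity)] at this
    exact this
  refine h3.trans ?_
  rw [← Real.mul_rpow (by linarith [one_le_kah P]) hr]
  have : (2:ℝ) ^ m ≤ kah P := by
    unfold kah; rw [← hm]; nlinarith [show (0:ℝ) < 2 ^ m by positivity]
  gcongr

lemma kah_down {X : Type*} [NormedAddCommGroup X] [NormedSpace ℝ X] {P : ℝ} (hP : 1 ≤ P)
    {K : ℕ} (x : Fin K → X) :
    radNorm x ^ P ≤ kah P ^ P * ((∑ ε, ‖ssum x ε‖ ^ P) / 2 ^ K) := by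
  have h := kahane_one x
  have hr := radNorm_nonneg x
  have hk : 16 ≤ kah P := by
    have : (1:ℝ) ≤ 2 ^ ⌈P⌉₊ := one_le_pow₀ (by norm_num)
    unfold kah; linarith
  calc radNorm x ^ P ≤ (kah P * ((∑ ε, ‖ssum x ε‖) / 2 ^ K)) ^ P := by
        refine Real.rpow_le_rpow hr (h.trans ?_) (by linarith)
        gcongr
    _ = kah P ^ P * ((∑ ε, ‖ssum x ε‖) / 2 ^ K) ^ P :=
        Real.mul_rpow (by linarith) (by positivity)
    _ ≤ _ := by
        have := jensen_unif (fun ε => ‖ssum x ε‖) (fun _ => by positivity) hP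
        gcongr

/-- extended radNorm -/
def radE {X : Type*} [NormedAddCommGroup X] {K : ℕ} (x : Fin K → X) : ℝ≥0∞ :=
  ENNReal.ofReal (radNorm x)

/-- extended average -/
def avE {X : Type*} [NormedAddCommGroup X] {K : ℕ} (P : ℝ) (x : Fin K → X) : ℝ≥0∞ :=
  (∑ ε, ‖ssum x ε‖ₑ ^ P) * (2 ^ K)⁻¹

lemma avE_eq {X : Type*} [NormedAddCommGroup X] {K : ℕ} {P : ℝ} (hP : 1 ≤ P) (x : Fin K → X) :
    avE P x = ENNReal.ofReal ((∑ ε, ‖ssum x ε‖ ^ P) / 2 ^ K) := by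
  rw [avE, div_eq_mul_inv, ENNReal.ofReal_mul (by positivity), ENNReal.ofReal_sum_of_nonneg
    (fun _ _ => by positivity), ENNReal.ofReal_inv_of_pos (by positivity), ENNReal.ofReal_pow (by norm_num)]
  simp [← ENNReal.ofReal_rpow_of_nonneg, show 0 ≤ P by linarith]

lemma avE_le {X : Type*} [NormedAddCommGroup X] [NormedSpace ℝ X] {P : ℝ} (hP : 1 ≤ P)
    {K : ℕ} (x : Fin K → X) : avE P x ≤ ENNReal.ofReal (kah P) ^ P * radE x ^ P := by
  have h0 : 0 ≤ kah P := by linarith [one_le_kah P]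
  rw [avE_eq hP, radE, ENNReal.ofReal_rpow_of_nonneg h0 (by linarith),
    ENNReal.ofReal_rpow_of_nonneg (radNorm_nonneg x) (by linarith), ← ENNReal.ofReal_mul (by positivity)]
  exact ENNReal.ofReal_le_ofReal (kah_up hP x)

lemma le_avE {X : Type*} [NormedAddCommGroup X] [NormedSpace ℝ X] {P : ℝ} (hP : 1 ≤ P)
    {K : ℕ} (x : Fin K → X) : radE x ^ P ≤ ENNReal.ofReal (kah P) ^ P * avE P x := by
  have h0 : 0 ≤ kah P := by linarith [one_le_kah P]
  rw [avE_eq hP, radE, ENNReal.ofReal_rpow_of_nonneg h0 (by linarith),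
    ENNReal.ofReal_rpow_of_nonneg (radNorm_nonneg x) (by linarith), ← ENNReal.ofReal_mul (by positivity)]
  exact ENNReal.ofReal_le_ofReal (kah_down hP x)

section Lp
variable {Ω : Type*} {mΩ : MeasurableSpace Ω} {μ : Measure Ω}

lemma lintegral_enorm_Lp {X : Type*} [NormedAddCommGroup X] {p : ℝ≥0∞} (h1 : 1 < p) (h2 : p ≠ ⊤)
    (g : Lp X p μ) : ∫⁻ ω, ‖g ω‖ₑ ^ p.toReal ∂μ = ‖g‖ₑ ^ p.toReal := by
  have h0 : p ≠ 0 := (zero_lt_one.trans h1).ne'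
  have : p.toReal ≠ 0 := (ENNReal.toReal_pos h0 h2).ne'
  rw [Lp.enorm_def, eLpNorm_eq_lintegral_rpow_enorm_toReal h0 h2, ← ENNReal.rpow_mul,
    one_div, inv_mul_cancel₀ this, ENNReal.rpow_one]

lemma coeFn_ssum {X : Type*} [NormedAddCommGroup X] {p : ℝ≥0∞} {K : ℕ}
    (g : Fin K → Lp X p μ) (ε : Fin K → Bool) :
    (ssum g ε : Lp X p μ) =ᵐ[μ] fun ω => ssum (fun k => g k ω) ε := by
  have h1 : ∀ᵐ ω ∂μ, ∀ k, (-g k : Lp X p μ) ω = - g k ω := by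
    rw [ae_all_iff]; intro k
    exact Lp.coeFn_neg (g k)
  have h2 : ∀ s : Finset (Fin K), ∀ᵐ ω ∂μ, (∑ k ∈ s, (if ε k then g k else - g k) : Lp X p μ) ω =
      ∑ k ∈ s, (if ε k then g k else - g k : Lp X p μ) ω := by
    intro s
    induction s using Finset.induction_on with
    | empty =>
      simp only [Finset.sum_empty]
      exact Lp.coeFn_zero X p μ
    | insert a s ha ih =>
      simp only [Finset.sum_insert ha]
      filter_upwards [ih, Lp.coeFn_add (if ε a then g a else - g a)
        (∑ k ∈ s, (if ε k then g k else - g k))] with ω h3 h4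
      rw [h4, Pi.add_apply, h3]
  filter_upwards [h1, h2 Finset.univ] with ω h3 h4
  rw [ssum, h4, ssum]
  refine Finset.sum_congr rfl fun k _ => ?_
  split_ifs
  · rfl
  · exact h3 k

lemma lintegral_avE {X : Type*} [NormedAddCommGroup X] {p : ℝ≥0∞} (h1 : 1 < p) (h2 : p ≠ ⊤)
    {K : ℕ} [Fact (1 ≤ p)] (g : Fin K → Lp X p μ) :
    ∫⁻ ω, avE p.toReal (fun k => g k ω) ∂μ = avE p.toReal g := by
  simp only [avE]
  rw [lintegral_mul_const']
  swap
  · simp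
  congr 1
  have : ∀ ε, ‖ssum g ε‖ₑ ^ p.toReal = ∫⁻ ω, ‖ssum (fun k => g k ω) ε‖ₑ ^ p.toReal ∂μ := by
    intro ε
    rw [← lintegral_enorm_Lp h1 h2]
    apply lintegral_congr_ae
    filter_upwards [coeFn_ssum g ε] with ω h
    rw [h]
  simp only [this]
  rw [lintegral_finsetSum']
  intro ε _
  have : AEStronglyMeasurable (fun ω => ssum (fun k => g k ω) ε) μ :=
    (Lp.aestronglyMeasurable (ssum g ε)).congr (coeFn_ssum g ε)
  exact this.enorm.pow_const _

/-- constant in the Fubini-Kahane comparison -/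
def kahE (p : ℝ≥0∞) : ℝ≥0∞ := ENNReal.ofReal (kah p.toReal) ^ 2

lemma one_le_kahE (p : ℝ≥0∞) : 1 ≤ kahE p := by
  have : 1 ≤ ENNReal.ofReal (kah p.toReal) := by simpa using one_le_kah p.toReal
  exact one_le_pow₀ this

lemma kahE_ne_top (p : ℝ≥0∞) : kahE p ≠ ⊤ := by simp [kahE]

lemma lintegral_radE_le {X : Type*} [NormedAddCommGroup X] [NormedSpace ℝ X] {p : ℝ≥0∞}
    (h1 : 1 < p) (h2 : p ≠ ⊤)
    {K : ℕ} [Fact (1 ≤ p)] (g : Fin K → Lp X p μ) :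
    ∫⁻ ω, radE (fun k => g k ω) ^ p.toReal ∂μ ≤ (kahE p * radE g) ^ p.toReal := by
  have hP : 1 ≤ p.toReal := by
    simpa using ENNReal.toReal_mono h2 h1.le
  have hP0 : 0 ≤ p.toReal := by linarith
  have hc : ENNReal.ofReal (kah p.toReal) ^ p.toReal ≠ ⊤ :=
    ENNReal.rpow_ne_top_of_nonneg hP0 ENNReal.ofReal_ne_top
  calc _ ≤ ∫⁻ ω, ENNReal.ofReal (kah p.toReal) ^ p.toReal * avE p.toReal (fun k => g k ω) ∂μ :=
        lintegral_mono fun ω => le_avE hP _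
    _ = ENNReal.ofReal (kah p.toReal) ^ p.toReal * avE p.toReal g := by
        rw [lintegral_const_mul' _ _ hc, lintegral_avE h1 h2]
    _ ≤ ENNReal.ofReal (kah p.toReal) ^ p.toReal *
        (ENNReal.ofReal (kah p.toReal) ^ p.toReal * radE g ^ p.toReal) := by
        gcongr; exact avE_le hP g
    _ = _ := by
        rw [kahE, ENNReal.mul_rpow_of_nonneg _ _ hP0, sq, ENNReal.mul_rpow_of_nonneg _ _ hP0, mul_assoc]

lemma radE_Lp_le {X : Type*} [NormedAddCommGroup X] [NormedSpace ℝ X] {p : ℝ≥0∞}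
    (h1 : 1 < p) (h2 : p ≠ ⊤)
    {K : ℕ} [Fact (1 ≤ p)] (g : Fin K → Lp X p μ) :
    radE g ≤ kahE p * (∫⁻ ω, radE (fun k => g k ω) ^ p.toReal ∂μ) ^ (p.toReal)⁻¹ := by
  have hP : 1 ≤ p.toReal := by
    simpa using ENNReal.toReal_mono h2 h1.le
  have hP0 : 0 ≤ p.toReal := by linarith
  have hPp : 0 < p.toReal := by linarith
  have hc : ENNReal.ofReal (kah p.toReal) ^ p.toReal ≠ ⊤ :=
    ENNReal.rpow_ne_top_of_nonneg hP0 ENNReal.ofReal_ne_top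
  have key : radE g ^ p.toReal ≤ kahE p ^ p.toReal * ∫⁻ ω, radE (fun k => g k ω) ^ p.toReal ∂μ := by
    calc _ ≤ ENNReal.ofReal (kah p.toReal) ^ p.toReal * avE p.toReal g := le_avE hP _
      _ = ENNReal.ofReal (kah p.toReal) ^ p.toReal * ∫⁻ ω, avE p.toReal (fun k => g k ω) ∂μ := by
          rw [lintegral_avE h1 h2]
      _ ≤ ENNReal.ofReal (kah p.toReal) ^ p.toReal * ∫⁻ ω,
          ENNReal.ofReal (kah p.toReal) ^ p.toReal * radE (fun k => g k ω) ^ p.toReal ∂μ := by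
          gcongr; exact avE_le hP _
      _ = _ := by
          rw [lintegral_const_mul' _ _ hc, kahE, sq, ENNReal.mul_rpow_of_nonneg _ _ hP0, mul_assoc]
  have := ENNReal.rpow_le_rpow key (inv_nonneg.2 hP0)
  rwa [ENNReal.mul_rpow_of_nonneg _ _ (inv_nonneg.2 hP0), ← ENNReal.rpow_mul, ← ENNReal.rpow_mul,
    mul_inv_cancel₀ hPp.ne', ENNReal.rpow_one, ENNReal.rpow_one] at this

end Lp

/-! ### Generalities on RM constants -/

lemma radNorm_smul {X : Type*} [NormedAddCommGroup X] [NormedSpace ℂ X] {K : ℕ} (c : ℂ)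
    (x : Fin K → X) : radNorm (fun k => c • x k) = ‖c‖ * radNorm x := by
  have h : ∀ ε, ssum (fun k => c • x k) ε = c • ssum x ε := by
    intro ε
    simp only [ssum, Finset.smul_sum]
    refine Finset.sum_congr rfl fun k _ => ?_
    split_ifs <;> simp
  have : radNorm (fun k => c • x k) ^ 2 = (‖c‖ * radNorm x) ^ 2 := by
    rw [mul_pow, radNorm_sq, radNorm_sq]
    simp only [h, norm_smul, mul_pow, ← Finset.mul_sum, mul_div_assoc]
  exact (pow_left_inj₀ (radNorm_nonneg _) (mul_nonneg (norm_nonneg _) (radNorm_nonneg _))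
    two_ne_zero).1 this

lemma sum_bool_succ' {K : ℕ} {M : Type*} [AddCommMonoid M] (F : (Fin (K + 1) → Bool) → M) :
    ∑ ε, F ε = ∑ ε : Fin K → Bool, (F (Fin.snoc ε true) + F (Fin.snoc ε false)) := by
  rw [← (Fin.snocEquiv (fun _ : Fin (K+1) => Bool)).sum_comp, Fintype.sum_prod_type]
  simp [Finset.sum_add_distrib, Fin.snocEquiv]

lemma radNorm_snoc {X : Type*} [NormedAddCommGroup X] {K : ℕ} (x : Fin K → X) :
    radNorm (Fin.snoc x 0 : Fin (K + 1) → X) = radNorm x := by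
  have h : ∀ ε b, ssum (Fin.snoc x 0 : Fin (K + 1) → X) (Fin.snoc ε b) = ssum x ε := by
    intro ε b
    simp [ssum, Fin.sum_univ_castSucc]
  have : radNorm (Fin.snoc x 0 : Fin (K + 1) → X) ^ 2 = radNorm x ^ 2 := by
    rw [radNorm_sq, radNorm_sq, sum_bool_succ']
    simp only [h]
    rw [← Finset.sum_congr rfl (fun ε _ => two_mul (‖ssum x ε‖ ^ 2)), ← Finset.mul_sum, pow_succ]
    field_simp
  exact (pow_left_inj₀ (radNorm_nonneg _) (radNorm_nonneg _) two_ne_zero).1 this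

section RM2

variable {n : ℕ} {Z : Fin (n + 1) → Type*} [∀ j, NormedAddCommGroup (Z j)]

/-- admissible completions -/
def Adm (J : Finset (Fin (n + 1))) (v : Fin (n + 1)) {K : ℕ} (h : ∀ j, Fin K → Z j) : Prop :=
  (∃ gv : Z v, (∀ k, h v k = gv) ∧ ‖gv‖ ≤ 1) ∧ ∀ j, j ∉ J → j ≠ v → radNorm (h j) ≤ 1

/-- completion -/
def comb (J : Finset (Fin (n + 1))) {K : ℕ} (e h : ∀ j, Fin K → Z j) : ∀ j, Fin K → Z j :=
  fun j => if j ∈ J then e j else h j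

lemma RMfam_eq (ϖ : (∀ j, Z j) → ℂ) {J : Finset (Fin (n + 1))} {v : Fin (n + 1)} (hv : v ∉ J)
    {K : ℕ} (e : ∀ j, Fin K → Z j) :
    RMfam ϖ J v (fun j _ => e j) =
      ⨆ h : {h : ∀ j, Fin K → Z j // Adm J v h}, ‖∑ k, ϖ fun j => comb J e h.1 j k‖ₑ := by
  apply le_antisymm
  · refine iSup₂_le fun g hg => ?_
    have hc : comb J e g = g := by
      funext j
      by_cases hj : j ∈ J
      · simp [comb, hj, hg.1 j hj]
      · simp [comb, hj]
    refine le_trans (le_of_eq ?_) (le_iSup _ ⟨g, hg.2⟩)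
    simp only [hc, ofReal_norm]
  · refine iSup_le fun h => ?_
    refine le_trans (le_of_eq ?_) (le_iSup₂ (comb J e h.1) ⟨?_, ?_, ?_⟩)
    · simp
    · intro j hj; simp [comb, hj]
    · simpa [comb, hv] using h.2.1
    · intro j hj hjv; simpa [comb, hj] using h.2.2 j hj hjv

lemma RMfam_mono (ϖ : (∀ j, Z j) → ℂ) (hϖ : ∀ e j, e j = 0 → ϖ e = 0)
    {J : Finset (Fin (n + 1))} {v : Fin (n + 1)} (hvJ : v ∉ J)
    (j₀ : Fin (n + 1)) (hj0 : j₀ ∉ J) (hj0v : j₀ ≠ v)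
    (e : ∀ j, ℕ → Z j) (K : ℕ) :
    RMfam ϖ J v (fun j _ (k : Fin K) => e j k) ≤ RMfam ϖ J v (fun j _ (k : Fin (K + 1)) => e j k) := by
  refine iSup₂_le fun g hg => ?_
  obtain ⟨h1, ⟨gv, h2, h2'⟩, h3⟩ := hg
  let g' : ∀ j, Fin (K + 1) → Z j := fun j =>
    Fin.snoc (g j) (if j ∈ J then e j K else if h : j = v then (h ▸ gv) else 0)
  have hlast : g' j₀ (Fin.last K) = 0 := by simp [g', hj0, hj0v]
  refine le_trans (le_of_eq ?_) (le_iSup₂ g' ⟨?_, ⟨gv, ?_, h2'⟩, ?_⟩)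
  · congr 2
    rw [Fin.sum_univ_castSucc, hϖ _ j₀ hlast, add_zero]
    simp [g']
  · intro j hj
    funext k
    refine Fin.lastCases ?_ (fun k => ?_) k
    · simp [g', hj]
    · simp [g', h1 j hj]
  · intro k
    refine Fin.lastCases ?_ (fun k => ?_) k
    · simp [g', hvJ]
    · simp [g', h2]
  · intro j hj hjv
    simp only [g', hj, hjv, if_false, dif_neg, not_false_eq_true]
    rw [radNorm_snoc]
    exact h3 j hj hjv

variable [∀ j, NormedSpace ℂ (Z j)]

lemma RMfam_hom (ϖ : (∀ j, Z j) → ℂ)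
    (hϖ : ∀ (c : Fin (n + 1) → ℂ) e, ϖ (fun j => c j • e j) = (∏ j, c j) * ϖ e)
    {J : Finset (Fin (n + 1))} {v : Fin (n + 1)} (hv : v ∉ J) {K : ℕ} (g : ∀ j, Fin K → Z j)
    (gv : Z v) (hgv : ∀ k, g v k = gv) (t : Fin (n + 1) → ℝ) (htJ : ∀ j ∈ J, t j = 1)
    (htv : ‖gv‖ ≤ t v) (ht : ∀ j, j ∉ J → j ≠ v → radNorm (g j) ≤ t j) :
    ‖∑ k, ϖ fun j => g j k‖ₑ ≤ RMfam ϖ J v (fun j _ => g j) * ∏ j, ENNReal.ofReal (t j) := by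
  have ht0 : ∀ j, 0 ≤ t j := by
    intro j
    by_cases hj : j ∈ J
    · simp [htJ j hj]
    by_cases hjv : j = v
    · subst hjv; exact (norm_nonneg _).trans htv
    · exact (radNorm_nonneg _).trans (ht j hj hjv)
  by_cases h0 : ∃ j, t j = 0
  · obtain ⟨j, hj⟩ := h0
    have hz : ∀ k, g j k = 0 := by
      intro k
      rw [← norm_le_zero_iff]
      by_cases hjJ : j ∈ J
      · rw [htJ j hjJ] at hj; exact absurd hj one_ne_zero
      by_cases hjv : j = v
      · subst hjv; rw [hgv, ← hj]; exact htv
      · rw [← hj]; exact (norm_le_radNorm (g j) k).trans (ht j hjJ hjv)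
    have : ∀ k, ϖ (fun i => g i k) = 0 := by
      intro k
      have h := hϖ (fun i => if i = j then 0 else 1) (fun i => g i k)
      rw [Finset.prod_eq_zero (Finset.mem_univ j) (by simp), zero_mul] at h
      rw [← h]
      congr 1
      funext i
      by_cases hi : i = j
      · subst hi; simp [hz]
      · simp [hi]
    simp [this]
  push Not at h0
  have htp : ∀ j, 0 < t j := fun j => lt_of_le_of_ne (ht0 j) (h0 j).symm
  let g' : ∀ j, Fin K → Z j := fun j k => (((t j)⁻¹ : ℝ) : ℂ) • g j k
  have hn : ∀ j, ‖(((t j)⁻¹ : ℝ) : ℂ)‖ = (t j)⁻¹ := fun j => by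
    rw [Complex.norm_real, Real.norm_of_nonneg (inv_nonneg.2 (ht0 j))]
  have hle : ‖∑ k, ϖ fun j => g' j k‖ₑ ≤ RMfam ϖ J v (fun j _ => g j) := by
    refine le_trans (le_of_eq ?_) (le_iSup₂ g' ⟨?_, ⟨(((t v)⁻¹ : ℝ) : ℂ) • gv, ?_, ?_⟩, ?_⟩)
    · simp
    · intro j hj; funext k; simp [g', htJ j hj]
    · intro k; simp [g', hgv]
    · rw [norm_smul, hn, inv_mul_le_iff₀ (htp v)]; simpa using htv
    · intro j hj hjv
      rw [radNorm_smul, hn, inv_mul_le_iff₀ (htp j)]; simpa using ht j hj hjv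
  have e1 : ∑ k, ϖ (fun j => g' j k) = (∏ j, (((t j)⁻¹ : ℝ) : ℂ)) * ∑ k, ϖ (fun j => g j k) := by
    rw [Finset.mul_sum]
    exact Finset.sum_congr rfl fun k _ => hϖ _ _
  have e2 : ∑ k, ϖ (fun j => g j k) = (∏ j, ((t j : ℝ) : ℂ)) * ∑ k, ϖ (fun j => g' j k) := by
    rw [e1, ← mul_assoc, ← Finset.prod_mul_distrib]
    have : ∀ j, ((t j : ℝ) : ℂ) * (((t j)⁻¹ : ℝ) : ℂ) = 1 := by
      intro j; rw [← Complex.ofReal_mul, mul_inv_cancel₀ (h0 j)]; simp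
    simp only [this, Finset.prod_const_one, one_mul]
  rw [e2, enorm_mul, mul_comm]
  refine mul_le_mul' hle (le_of_eq ?_)
  rw [← Complex.ofReal_prod, ← ENNReal.ofReal_prod_of_nonneg (fun j _ => ht0 j), ← ofReal_norm,
    Complex.norm_real, Real.norm_of_nonneg (Finset.prod_nonneg fun j _ => ht0 j)]

lemma IsContraction.hom {ϖ : (∀ j, Z j) → ℂ} (h : IsContraction ϖ) (c : Fin (n + 1) → ℂ)
    (e : ∀ j, Z j) : ϖ (fun j => c j • e j) = (∏ j, c j) * ϖ e := by
  obtain ⟨⟨Λ, rfl⟩, -⟩ := h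
  rw [Λ.map_smul_univ]; rfl

lemma IsContraction.zero {ϖ : (∀ j, Z j) → ℂ} (h : IsContraction ϖ) 
    (e : ∀ j, Z j) (j) (he : e j = 0) : ϖ e = 0 := by
  obtain ⟨⟨Λ, rfl⟩, -⟩ := h
  exact Λ.map_coord_zero j he

lemma IsContraction.continuous {ϖ : (∀ j, Z j) → ℂ} (h : IsContraction ϖ) : Continuous ϖ := by
  obtain ⟨⟨Λ, rfl⟩, h2⟩ := h
  exact Λ.continuous_of_bound 1 (by simpa using h2)

lemma IsContraction.bound {ϖ : (∀ j, Z j) → ℂ} (h : IsContraction ϖ)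
    (e : ∀ j, Z j) : ‖ϖ e‖ₑ ≤ ∏ j, ‖e j‖ₑ := by
  rw [← ofReal_norm]
  refine (ENNReal.ofReal_le_ofReal (h.2 e)).trans (le_of_eq ?_)
  rw [ENNReal.ofReal_prod_of_nonneg (fun _ _ => norm_nonneg _)]
  simp

lemma Adm.norm_le {J : Finset (Fin (n + 1))} {v : Fin (n + 1)} {K : ℕ} {h : ∀ j, Fin K → Z j}
    (hh : Adm J v h) (j) (hj : j ∉ J) (k : Fin K) : ‖h j k‖ ≤ 1 := by
  by_cases hjv : j = v
  · subst hjv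
    obtain ⟨⟨gv, h1, h2⟩, -⟩ := hh
    rw [h1]; exact h2
  · exact (norm_le_radNorm (h j) k).trans (hh.2 j hj hjv)

lemma RMfam_le {ϖ : (∀ j, Z j) → ℂ} (hϖ : IsContraction ϖ)
    {J : Finset (Fin (n + 1))} {v : Fin (n + 1)} (hv : v ∉ J) {K : ℕ} (e : ∀ j, Fin K → Z j) :
    RMfam ϖ J v (fun j _ => e j) ≤ ∑ k, ∏ j ∈ J, ‖e j k‖ₑ := by
  rw [RMfam_eq ϖ hv]
  refine iSup_le fun h => ?_
  refine (enorm_sum_le _ _).trans (Finset.sum_le_sum fun k _ => (hϖ.bound _).trans ?_)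
  rw [← Finset.prod_mul_prod_compl J]
  refine (mul_le_mul' (le_of_eq ?_) (Finset.prod_le_one' fun j hj => ?_)).trans_eq (mul_one _)
  · exact Finset.prod_congr rfl fun j hj => by simp [comb, hj]
  · have hj : j ∉ J := by simpa using hj
    have := h.2.norm_le j hj k
    simp only [comb, hj, if_false]
    rw [← ofReal_norm]
    exact ENNReal.ofReal_le_one.2 this

lemma countable_sup {Y : Type*} [TopologicalSpace Y] [SecondCountableTopology Y] {ι : Type*}
    [Nonempty ι] (φ : ι → Y → ℝ≥0∞) (hφ : ∀ i, Continuous (φ i)) :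
    ∃ h : ℕ → ι, ∀ y, ⨆ i, φ i y = ⨆ m, φ (h m) y := by
  obtain ⟨T, hT, hU⟩ := TopologicalSpace.isOpen_iUnion_countable
    (fun i => {q : Y × ℝ≥0∞ | q.2 < φ i q.1})
    (fun i => isOpen_lt continuous_snd ((hφ i).comp continuous_fst))
  obtain ⟨i₀⟩ := ‹Nonempty ι›
  obtain ⟨h, hh⟩ := (hT.insert i₀).exists_eq_range ⟨i₀, Set.mem_insert _ _⟩
  refine ⟨h, fun y => le_antisymm (iSup_le fun i => ?_) (iSup_le fun m => le_iSup (fun i => φ i y) _)⟩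
  by_contra! hlt
  have hm : (y, ⨆ m, φ (h m) y) ∈ ⋃ i, {q : Y × ℝ≥0∞ | q.2 < φ i q.1} :=
    Set.mem_iUnion.2 ⟨i, hlt⟩
  rw [← hU] at hm
  simp only [Set.mem_iUnion] at hm
  obtain ⟨i', hi', hlt'⟩ := hm
  have : i' ∈ Set.range h := hh ▸ Set.mem_insert_of_mem _ hi'
  obtain ⟨m, rfl⟩ := this
  exact absurd (le_iSup (fun m => φ (h m) y) m) (not_le.2 hlt')

lemma continuous_comb (J : Finset (Fin (n + 1))) {K : ℕ} (h : ∀ j, Fin K → Z j) (k : Fin K) :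
    Continuous fun e : ∀ j, Fin K → Z j => fun j => comb J e h j k := by
  refine continuous_pi fun j => ?_
  by_cases hj : j ∈ J
  · simp only [comb, hj, if_true]; fun_prop
  · simp only [comb, hj, if_false]; fun_prop

lemma exists_countable {ϖ : (∀ j, Z j) → ℂ} (hϖ : Continuous ϖ)
    {J : Finset (Fin (n + 1))} {v : Fin (n + 1)} (hv : v ∉ J) {K : ℕ}
    {Ω : Type*} [MeasurableSpace Ω] (F : ∀ j, Fin K → Ω → Z j)
    (hF : ∀ j k, StronglyMeasurable (F j k)) :
    ∃ h : ℕ → {h : ∀ j, Fin K → Z j // Adm J v h},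
      ∀ ω, RMfam ϖ J v (fun j _ k => F j k ω) =
        ⨆ m, ‖∑ k, ϖ fun j => comb J (fun j k => F j k ω) (h m).1 j k‖ₑ := by
  let S : Set (∀ j, Fin K → Z j) :=
    Set.univ.pi fun j => Set.univ.pi fun k => Set.range (F j k)
  have hS : TopologicalSpace.IsSeparable S :=
    TopologicalSpace.IsSeparable.univ_pi fun j => TopologicalSpace.IsSeparable.univ_pi fun k =>
      (hF j k).isSeparable_range
  have := hS.separableSpace
  have : SecondCountableTopology S := UniformSpace.secondCountable_of_separable S
  have : Nonempty {h : ∀ j, Fin K → Z j // Adm J v h} :=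
    ⟨⟨fun _ _ => 0, ⟨0, by simp⟩, fun j _ _ => by simp [radNorm]⟩⟩
  obtain ⟨h, hh⟩ := countable_sup (Y := S)
    (fun (h : {h : ∀ j, Fin K → Z j // Adm J v h}) e => ‖∑ k, ϖ fun j => comb J e.1 h.1 j k‖ₑ)
    (fun h => (continuous_finsetSum _ fun k _ =>
      hϖ.comp ((continuous_comb J h.1 k).comp continuous_subtype_val)).enorm)
  refine ⟨h, fun ω => ?_⟩
  rw [RMfam_eq ϖ hv (fun j k => F j k ω)]
  exact hh ⟨fun j k => F j k ω, by simp [S, Set.mem_pi]⟩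

end RM2

/-! ### The Bochner setting -/

section Main

variable {n : ℕ} {p : Fin (n + 1) → ℝ≥0∞} [∀ j, Fact (1 ≤ p j)]
  {Z : Fin (n + 1) → Type*} [∀ j, NormedAddCommGroup (Z j)] [∀ j, NormedSpace ℂ (Z j)]
  {Ω : Type*} {mΩ : MeasurableSpace Ω} {μ : Measure Ω}

lemma toReal_gt_one {q : ℝ≥0∞} (h : 1 < q ∧ q ≠ ⊤) : 1 < q.toReal := by
  have := (ENNReal.toReal_lt_toReal ENNReal.one_ne_top h.2).2 h.1
  simpa using this

lemma inv_toReal_sum (hp : ∀ j, 1 < p j ∧ p j ≠ ⊤) (s : Finset (Fin (n + 1))) :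
    (∑ j ∈ s, (p j)⁻¹).toReal = ∑ j ∈ s, ((p j).toReal)⁻¹ := by
  rw [ENNReal.toReal_sum]
  · simp
  · intro j _
    exact ENNReal.inv_ne_top.2 (zero_lt_one.trans (hp j).1).ne'

lemma stronglyMeasurable_pi' {g : ∀ j, Ω → Z j} (hg : ∀ j, StronglyMeasurable (g j)) :
    StronglyMeasurable fun ω => fun j => g j ω := by
  refine ⟨fun m => ⟨fun ω j => (hg j).approx m ω, ?_, ?_⟩, ?_⟩
  · intro y
    have : (fun ω j => (hg j).approx m ω) ⁻¹' {y} = ⋂ j, (hg j).approx m ⁻¹' {y j} := by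
      ext ω; simp [funext_iff]
    rw [this]
    exact MeasurableSet.iInter fun j => ((hg j).approx m).measurableSet_fiber _
  · refine (Set.Finite.pi' fun j => ((hg j).approx m).finite_range).subset ?_
    rintro _ ⟨ω, rfl⟩ j
    exact ⟨ω, rfl⟩
  · intro ω
    exact tendsto_pi_nhds.2 fun j => (hg j).tendsto_approx ω

lemma lintegral_prod_enorm_le (hp : ∀ j, 1 < p j ∧ p j ≠ ⊤) (hsum : ∑ j, (p j)⁻¹ = 1)
    (g : ∀ j, Lp (Z j) (p j) μ) :
    ∫⁻ ω, ∏ j, ‖g j ω‖ₑ ∂μ ≤ ∏ j, ‖g j‖ₑ := by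
  have hP : ∀ j, 0 < (p j).toReal := fun j => by linarith [toReal_gt_one (hp j)]
  have h := ENNReal.lintegral_prod_norm_pow_le (μ := μ) Finset.univ
    (f := fun j ω => ‖g j ω‖ₑ ^ (p j).toReal)
    (fun j _ => (Lp.aestronglyMeasurable (g j)).enorm.pow_const _)
    (p := fun j => ((p j).toReal)⁻¹) (by rw [← inv_toReal_sum hp, hsum]; simp)
    (fun j _ => inv_nonneg.2 (hP j).le)
  simpa only [lintegral_enorm_Lp (hp _).1 (hp _).2, ENNReal.rpow_rpow_inv (hP _).ne'] using h

lemma integrable_W (hp : ∀ j, 1 < p j ∧ p j ≠ ⊤) (hsum : ∑ j, (p j)⁻¹ = 1)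
    {ϖ : (∀ j, Z j) → ℂ} (hϖ : IsContraction ϖ) (g : ∀ j, Lp (Z j) (p j) μ) :
    Integrable (fun ω => ϖ fun j => g j ω) μ := by
  refine ⟨(hϖ.continuous.comp_stronglyMeasurable (stronglyMeasurable_pi'
    fun j => Lp.stronglyMeasurable (g j))).aestronglyMeasurable, ?_⟩
  refine lt_of_le_of_lt (lintegral_mono fun ω => hϖ.bound _) ?_
  refine (lintegral_prod_enorm_le hp hsum g).trans_lt ?_
  exact ENNReal.prod_lt_top fun j _ => enorm_lt_top

/-- the induced form -/
abbrev WW (μ : Measure Ω) (p : Fin (n + 1) → ℝ≥0∞) (ϖ : (∀ j, Z j) → ℂ) :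
    (∀ j, Lp (Z j) (p j) μ) → ℂ :=
  fun g => ∫ ω, ϖ (fun j => (g j : Ω → Z j) ω) ∂μ

lemma WW_hom {ϖ : (∀ j, Z j) → ℂ} (hϖ : IsContraction ϖ) (c : Fin (n + 1) → ℂ)
    (g : ∀ j, Lp (Z j) (p j) μ) :
    WW μ p ϖ (fun j => c j • g j) = (∏ j, c j) * WW μ p ϖ g := by
  simp only [WW]
  rw [← integral_const_mul]
  apply integral_congr_ae
  have : ∀ᵐ ω ∂μ, ∀ j, (c j • g j : Lp (Z j) (p j) μ) ω = c j • g j ω := by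
    rw [ae_all_iff]; intro j; exact Lp.coeFn_smul (c j) (g j)
  filter_upwards [this] with ω h
  simp only [h]
  exact hϖ.hom c _

lemma measurable_RM {ϖ : (∀ j, Z j) → ℂ} (hϖ : Continuous ϖ)
    {J : Finset (Fin (n + 1))} {v : Fin (n + 1)} (hv : v ∉ J) {K : ℕ}
    (F : ∀ j, Fin K → Ω → Z j) (hF : ∀ j k, StronglyMeasurable (F j k)) :
    Measurable fun ω => RMfam ϖ J v (fun j _ k => F j k ω) := by
  obtain ⟨h, hh⟩ := exists_countable hϖ hv F hF
  simp only [hh]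
  refine Measurable.iSup fun m => ?_
  refine StronglyMeasurable.enorm ?_
  refine Finset.stronglyMeasurable_fun_sum _ fun k _ => ?_
  refine hϖ.comp_stronglyMeasurable (stronglyMeasurable_pi' fun j => ?_)
  by_cases hj : j ∈ J
  · simpa only [comb, hj, if_true] using hF j k
  · simp only [comb, hj, if_false]; exact stronglyMeasurable_const

lemma measurable_radE {X : Type*} [NormedAddCommGroup X] {K : ℕ} (g : Fin K → Ω → X)
    (hg : ∀ k, StronglyMeasurable (g k)) : Measurable fun ω => radE (fun k => g k ω) := by
  unfold radE radNorm
  refine ENNReal.measurable_ofReal.comp (Real.continuous_sqrt.measurable.comp ?_)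
  refine Measurable.div_const (Finset.measurable_fun_sum _ fun ε _ => ?_) _
  refine Measurable.pow_const ?_ 2
  refine (Finset.stronglyMeasurable_fun_sum _ fun k _ => ?_).norm.measurable
  split_ifs
  · exact hg k
  · exact (hg k).neg

/-- the total constant -/
def cc (p : Fin (n + 1) → ℝ≥0∞) : ℝ≥0∞ := ∏ j, kahE (p j)

lemma prod_kahE_le (s : Finset (Fin (n + 1))) : ∏ j ∈ s, kahE (p j) ≤ cc p :=
  Finset.prod_le_prod_of_subset_of_one_le' (Finset.subset_univ s) fun j _ _ => one_le_kahE (p j)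

lemma cc_ne_top : cc p ≠ ⊤ := ENNReal.prod_ne_top fun j _ => kahE_ne_top (p j)

lemma upper (hp : ∀ j, 1 < p j ∧ p j ≠ ⊤) (hsum : ∑ j, (p j)⁻¹ = 1)
    {ϖ : (∀ j, Z j) → ℂ} (hϖ : IsContraction ϖ)
    {J : Finset (Fin (n + 1))} {v : Fin (n + 1)} (hv : v ∉ J) {K : ℕ}
    {r : ℝ} (hr : 0 < r) (hrJ : r⁻¹ = ∑ j ∈ J, ((p j).toReal)⁻¹)
    (F : ∀ j, Fin K → Lp (Z j) (p j) μ) :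
    RMfam (Z := fun j => Lp (Z j) (p j) μ) (WW μ p ϖ) J v (fun j _ => F j) ≤
      cc p * (∫⁻ ω, RMfam ϖ J v (fun j _ k => (F j k : Ω → Z j) ω) ^ r ∂μ) ^ r⁻¹ := by
  have hP : ∀ j, 0 < (p j).toReal := fun j => by linarith [toReal_gt_one (hp j)]
  refine iSup₂_le fun g hg => ?_
  obtain ⟨h1, ⟨gv, h2, h2'⟩, h3⟩ := hg
  let t : Fin (n + 1) → Ω → ℝ := fun j ω =>
    if j ∈ J then 1 else if j = v then ‖gv ω‖ else radNorm (fun k => g j k ω)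
  have hpt : ∀ ω, ‖∑ k, ϖ fun j => g j k ω‖ₑ ≤
      RMfam ϖ J v (fun j _ k => (F j k : Ω → Z j) ω) * ∏ j ∈ Jᶜ, ENNReal.ofReal (t j ω) := by
    intro ω
    have := RMfam_hom ϖ hϖ.hom hv (fun j k => g j k ω) (gv ω) (fun k => by rw [h2])
      (fun j => t j ω) (fun j hj => by simp [t, hj]) (by simp [t, hv])
      (fun j hj hjv => by simp [t, hj, hjv])
    refine this.trans (le_of_eq ?_)
    congr 1
    · congr 1
      funext j hj k
      rw [h1 j hj]
    · rw [← Finset.prod_mul_prod_compl J, Finset.prod_eq_one, one_mul]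
      intro j hj; simp [t, hj]
  have htm : ∀ j, Measurable fun ω => ENNReal.ofReal (t j ω) := by
    intro j
    simp only [t]
    split_ifs
    · simp
    · exact (Lp.stronglyMeasurable gv).norm.measurable.ennreal_ofReal
    · exact measurable_radE (fun k => g j k) (fun k => Lp.stronglyMeasurable (g j k))
  have hti : ∀ j ∈ Jᶜ, (∫⁻ ω, ENNReal.ofReal (t j ω) ^ (p j).toReal ∂μ) ^ ((p j).toReal)⁻¹ ≤
      kahE (p j) := by
    intro j hj
    have hj : j ∉ J := by simpa using hj
    have hgoal : ∫⁻ ω, ENNReal.ofReal (t j ω) ^ (p j).toReal ∂μ ≤ kahE (p j) ^ (p j).toReal := by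
      by_cases hjv : j = v
      · subst hjv
        simp only [t, hj, if_false, if_true, ofReal_norm]
        rw [lintegral_enorm_Lp (hp j).1 (hp j).2]
        refine ENNReal.rpow_le_rpow ?_ (hP j).le
        refine le_trans ?_ (one_le_kahE _)
        rw [← ofReal_norm]
        exact ENNReal.ofReal_le_one.2 h2'
      · simp only [t, hj, hjv, if_false]
        refine (lintegral_radE_le (hp j).1 (hp j).2 (g j)).trans ?_
        refine ENNReal.rpow_le_rpow ?_ (hP j).le
        refine mul_le_of_le_one_right' ?_
        exact ENNReal.ofReal_le_one.2 (h3 j hj hjv)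
    have := ENNReal.rpow_le_rpow hgoal (inv_nonneg.2 (hP j).le)
    rwa [ENNReal.rpow_rpow_inv (hP j).ne'] at this
  have hint : ∀ k ∈ Finset.univ, Integrable (fun ω => ϖ fun j => g j k ω) μ :=
    fun k _ => integrable_W hp hsum hϖ (fun j => g j k)
  have hold := ENNReal.lintegral_mul_prod_norm_pow_le (μ := μ) Jᶜ
    (g := fun ω => RMfam ϖ J v (fun j _ k => (F j k : Ω → Z j) ω) ^ r)
    (f := fun j ω => ENNReal.ofReal (t j ω) ^ (p j).toReal)
    ((measurable_RM hϖ.continuous hv (fun j k => F j k)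
      (fun j k => Lp.stronglyMeasurable (F j k))).pow_const r).aemeasurable
    (fun j _ => ((htm j).pow_const _).aemeasurable)
    (q := r⁻¹) (p := fun j => ((p j).toReal)⁻¹)
    (by rw [hrJ, Finset.sum_add_sum_compl, ← inv_toReal_sum hp, hsum]; simp)
    (inv_nonneg.2 hr.le) (fun j _ => inv_nonneg.2 (hP j).le)
  simp only [ENNReal.rpow_rpow_inv (hP _).ne', ENNReal.rpow_rpow_inv hr.ne'] at hold
  calc ENNReal.ofReal ‖∑ k, WW μ p ϖ fun j => g j k‖
      = ‖∫ ω, ∑ k, ϖ (fun j => g j k ω) ∂μ‖ₑ := by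
        rw [integral_finsetSum _ hint, ofReal_norm]
    _ ≤ ∫⁻ ω, ‖∑ k, ϖ (fun j => g j k ω)‖ₑ ∂μ := enorm_integral_le_lintegral_enorm _
    _ ≤ _ := lintegral_mono hpt
    _ ≤ _ := hold
    _ ≤ (∫⁻ ω, RMfam ϖ J v (fun j _ k => (F j k : Ω → Z j) ω) ^ r ∂μ) ^ r⁻¹ * cc p := by
        gcongr
        exact (Finset.prod_le_prod' hti).trans (prod_kahE_le _)
    _ = _ := mul_comm _ _

end Main

section Lower

variable {n : ℕ} {p : Fin (n + 1) → ℝ≥0∞} [∀ j, Fact (1 ≤ p j)]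
  {Z : Fin (n + 1) → Type*} [∀ j, NormedAddCommGroup (Z j)] [∀ j, NormedSpace ℂ (Z j)]
  {Ω : Type*} {mΩ : MeasurableSpace Ω} {μ : Measure Ω}

lemma ennreal_rpow_sum {ι : Type*} {A : ℝ≥0∞} (h0 : A ≠ 0) (ht : A ≠ ⊤) (s : Finset ι)
    (f : ι → ℝ) : ∏ j ∈ s, A ^ f j = A ^ ∑ j ∈ s, f j := by
  induction s using Finset.induction with
  | empty => simp
  | insert a s ha ih => rw [Finset.prod_insert ha, Finset.sum_insert ha, ih, ENNReal.rpow_add _ _ h0 ht]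

lemma RM_lt_top {ϖ : (∀ j, Z j) → ℂ} (hϖ : IsContraction ϖ)
    {J : Finset (Fin (n + 1))} {v : Fin (n + 1)} (hv : v ∉ J) {K : ℕ} (e : ∀ j, Fin K → Z j) :
    RMfam ϖ J v (fun j _ => e j) < ⊤ :=
  (RMfam_le hϖ hv e).trans_lt
    (ENNReal.sum_lt_top.2 fun _ _ => ENNReal.prod_lt_top fun _ _ => enorm_lt_top)

lemma lintegral_RM_lt_top (hp : ∀ j, 1 < p j ∧ p j ≠ ⊤)
    {ϖ : (∀ j, Z j) → ℂ} (hϖ : IsContraction ϖ)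
    {J : Finset (Fin (n + 1))} {v : Fin (n + 1)} (hv : v ∉ J) {K : ℕ}
    {r : ℝ} (hr : 1 ≤ r) (hrJ : r⁻¹ = ∑ j ∈ J, ((p j).toReal)⁻¹)
    (F : ∀ j, Fin K → Lp (Z j) (p j) μ) :
    ∫⁻ ω, RMfam ϖ J v (fun j _ k => (F j k : Ω → Z j) ω) ^ r ∂μ < ⊤ := by
  have hP : ∀ j, 0 < (p j).toReal := fun j => by linarith [toReal_gt_one (hp j)]
  have hr0 : 0 < r := by linarith
  have hk : ∀ k, ∫⁻ ω, (∏ j ∈ J, ‖F j k ω‖ₑ) ^ r ∂μ < ⊤ := by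
    intro k
    have h := ENNReal.lintegral_prod_norm_pow_le (μ := μ) J
      (f := fun j ω => ‖F j k ω‖ₑ ^ (p j).toReal)
      (fun j _ => (Lp.aestronglyMeasurable (F j k)).enorm.pow_const _)
      (p := fun j => ((p j).toReal)⁻¹ * r)
      (by rw [← Finset.sum_mul, ← hrJ, inv_mul_cancel₀ hr0.ne'])
      (fun j _ => mul_nonneg (inv_nonneg.2 (hP j).le) hr0.le)
    simp only [lintegral_enorm_Lp (hp _).1 (hp _).2, ENNReal.rpow_mul,
      ENNReal.rpow_rpow_inv (hP _).ne', ENNReal.prod_rpow_of_nonneg hr0.le] at h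
    refine h.trans_lt (ENNReal.rpow_lt_top_of_nonneg hr0.le ?_)
    exact (ENNReal.prod_lt_top fun j _ => enorm_lt_top).ne
  have hpt : ∀ ω, RMfam ϖ J v (fun j _ k => (F j k : Ω → Z j) ω) ^ r ≤
      (K : ℝ≥0∞) ^ (r - 1) * ∑ k, (∏ j ∈ J, ‖F j k ω‖ₑ) ^ r := by
    intro ω
    refine (ENNReal.rpow_le_rpow (RMfam_le hϖ hv (fun j k => F j k ω)) hr0.le).trans ?_
    refine (ENNReal.rpow_sum_le_const_mul_sum_rpow _ _ hr).trans_eq ?_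
    simp
  refine (lintegral_mono hpt).trans_lt ?_
  have hm : ∀ k, Measurable fun ω => (∏ j ∈ J, ‖F j k ω‖ₑ) ^ r := fun k =>
    (Finset.measurable_fun_prod _ fun j _ => (Lp.stronglyMeasurable (F j k)).enorm).pow_const r
  rw [lintegral_const_mul _ (Finset.measurable_fun_sum _ fun k _ => hm k),
    lintegral_finsetSum _ (fun k _ => hm k)]
  refine ENNReal.mul_lt_top (ENNReal.rpow_lt_top_of_nonneg (by linarith) (by simp)) ?_
  exact ENNReal.sum_lt_top.2 fun k _ => hk k

lemma exists_select {R : Ω → ℝ≥0∞} {φ : ℕ → Ω → ℝ≥0∞} (hφ : ∀ m, Measurable (φ m))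
    (hR : ∀ ω, R ω = ⨆ m, φ m ω) (hfin : ∀ ω, R ω < ⊤) :
    ∃ i : Ω → ℕ, Measurable i ∧ ∀ ω, R ω ≤ 2 * φ (i ω) ω := by
  have hRm : Measurable R := by
    have : R = fun ω => ⨆ m, φ m ω := funext hR
    rw [this]; exact Measurable.iSup hφ
  have hex : ∀ ω, ∃ m, R ω ≤ 2 * φ m ω := by
    intro ω
    by_contra! hcon
    have h1 : R ω ≤ R ω / 2 := by
      conv_lhs => rw [hR]
      refine iSup_le fun m => ?_
      rw [ENNReal.le_div_iff_mul_le (by simp) (by simp), mul_comm]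
      exact (hcon m).le
    have h2 : R ω ≠ 0 := fun h => by simpa [h] using hcon 0
    exact absurd (ENNReal.half_lt_self h2 (hfin ω).ne) (not_lt.2 h1)
  exact ⟨fun ω => Nat.find (hex ω),
    measurable_find hex fun k => measurableSet_le hRm ((hφ k).const_mul 2),
    fun ω => Nat.find_spec (hex ω)⟩

end Lower

section Lower2

variable {n : ℕ} {p : Fin (n + 1) → ℝ≥0∞} [∀ j, Fact (1 ≤ p j)]
  {Z : Fin (n + 1) → Type*} [∀ j, NormedAddCommGroup (Z j)] [∀ j, NormedSpace ℂ (Z j)]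
  {Ω : Type*} {mΩ : MeasurableSpace Ω} {μ : Measure Ω}

lemma lower (hp : ∀ j, 1 < p j ∧ p j ≠ ⊤) (hsum : ∑ j, (p j)⁻¹ = 1)
    {ϖ : (∀ j, Z j) → ℂ} (hϖ : IsContraction ϖ)
    {J : Finset (Fin (n + 1))} {v : Fin (n + 1)} (hv : v ∉ J) {K : ℕ}
    {r : ℝ} (hr : 1 ≤ r) (hrJ : r⁻¹ = ∑ j ∈ J, ((p j).toReal)⁻¹)
    (F : ∀ j, Fin K → Lp (Z j) (p j) μ) :
    (∫⁻ ω, RMfam ϖ J v (fun j _ k => (F j k : Ω → Z j) ω) ^ r ∂μ) ^ r⁻¹ ≤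
      2 * cc p * RMfam (Z := fun j => Lp (Z j) (p j) μ) (WW μ p ϖ) J v (fun j _ => F j) := by
  have hP : ∀ j, 0 < (p j).toReal := fun j => by linarith [toReal_gt_one (hp j)]
  have hr0 : 0 < r := by linarith
  have hAt := lintegral_RM_lt_top (μ := μ) hp hϖ hv hr hrJ F
  have hRm := measurable_RM hϖ.continuous hv (fun j k => F j k)
      (fun j k => Lp.stronglyMeasurable (F j k))
  have hRt : ∀ ω, RMfam ϖ J v (fun j _ k => (F j k : Ω → Z j) ω) < ⊤ :=
    fun ω => RM_lt_top hϖ hv (fun j k => F j k ω)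
  obtain ⟨h, hh⟩ := exists_countable hϖ.continuous hv (fun j k => F j k)
      (fun j k => Lp.stronglyMeasurable (F j k))
  have hK0 : ∀ ω, K = 0 → RMfam ϖ J v (fun j _ k => (F j k : Ω → Z j) ω) = 0 := by
    intro ω hK
    subst hK
    have := RMfam_le hϖ hv (fun j k => F j k ω)
    simpa using this
  generalize hRdef : (fun ω => RMfam ϖ J v (fun j _ k => (F j k : Ω → Z j) ω)) = R at *
  have hRdef' : ∀ ω, RMfam ϖ J v (fun j _ k => (F j k : Ω → Z j) ω) = R ω := fun ω => by
    rw [← hRdef]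
  simp only [hRdef'] at *
  clear hRdef'
  set A : ℝ≥0∞ := ∫⁻ ω, R ω ^ r ∂μ with hA
  by_cases hA0 : A = 0
  · rw [hA0, ENNReal.zero_rpow_of_pos (inv_pos.2 hr0)]; exact bot_le
  have hK : K ≠ 0 := by
    intro hK
    apply hA0
    simp [hA, hK0 _ hK, hr0]
  have hcm : ∀ m j k, StronglyMeasurable fun ω => comb J (fun j k => F j k ω) (h m).1 j k := by
    intro m j k
    by_cases hj : j ∈ J
    · simpa only [comb, hj, if_true] using Lp.stronglyMeasurable (F j k)
    · simp only [comb, hj, if_false]; exact stronglyMeasurable_const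
  obtain ⟨i, him, hi⟩ := exists_select (R := R)
    (fun m => StronglyMeasurable.enorm (Finset.stronglyMeasurable_fun_sum _ fun k _ =>
      hϖ.continuous.comp_stronglyMeasurable (stronglyMeasurable_pi' fun j => hcm m j k))) hh hRt
  let C : ∀ j, Fin K → Ω → Z j := fun j k ω => comb J (fun j k => F j k ω) (h (i ω)).1 j k
  have hCm : ∀ j k, StronglyMeasurable (C j k) := by
    intro j k
    by_cases hj : j ∈ J
    · simpa only [C, comb, hj, if_true] using Lp.stronglyMeasurable (F j k)
    · simp only [C, comb, hj, if_false]
      exact (StronglyMeasurable.of_discrete (f := fun m => (h m).1 j k)).comp_measurable him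
  let z : Ω → ℂ := fun ω => ∑ k, ϖ fun j => C j k ω
  have hzm : StronglyMeasurable z := Finset.stronglyMeasurable_fun_sum _ fun k _ =>
      hϖ.continuous.comp_stronglyMeasurable (stronglyMeasurable_pi' fun j => hCm j k)
  have hRz : ∀ ω, (R ω).toReal ≤ 2 * ‖z ω‖ := by
    intro ω
    have := ENNReal.toReal_mono (ENNReal.mul_ne_top (by simp) enorm_ne_top) (hi ω)
    simpa using this
  let θ : Ω → ℂ := fun ω => (starRingEnd ℂ) (z ω) / (‖z ω‖ : ℂ)
  have hθm : StronglyMeasurable θ := by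
    refine Measurable.stronglyMeasurable ?_
    exact (Complex.continuous_conj.measurable.comp hzm.measurable).div
      (Complex.measurable_ofReal.comp hzm.norm.measurable)
  have hθz : ∀ ω, θ ω * z ω = (‖z ω‖ : ℂ) := by
    intro ω
    by_cases h0 : z ω = 0
    · simp [h0]
    · have : (‖z ω‖ : ℂ) ≠ 0 := by simpa using h0
      simp only [θ]
      rw [div_mul_eq_mul_div, Complex.conj_mul']
      field_simp
  have hθ1 : ∀ ω, ‖θ ω‖ ≤ 1 := by
    intro ω
    simp only [θ, norm_div, RCLike.norm_conj, Complex.norm_real, norm_norm]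
    exact div_self_le_one _
  let W : Fin (n + 1) → Ω → ℝ := fun j ω =>
    if j ∈ J then 1 else (R ω).toReal ^ (r * ((p j).toReal)⁻¹)
  have hWm : ∀ j, Measurable (W j) := by
    intro j
    simp only [W]
    split_ifs
    · exact measurable_const
    · exact hRm.ennreal_toReal.pow_const _
  have hW0 : ∀ j ω, 0 ≤ W j ω := by
    intro j ω
    simp only [W]
    split_ifs
    · exact zero_le_one
    · exact Real.rpow_nonneg ENNReal.toReal_nonneg _
  have hWP : ∀ j, j ∉ J → ∫⁻ ω, ENNReal.ofReal (W j ω) ^ (p j).toReal ∂μ = A := by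
    intro j hj
    refine lintegral_congr fun ω => ?_
    simp only [W, hj, if_false]
    rw [← ENNReal.ofReal_rpow_of_nonneg ENNReal.toReal_nonneg
      (mul_nonneg hr0.le (inv_nonneg.2 (hP j).le)), ENNReal.ofReal_toReal (hRt ω).ne,
      ← ENNReal.rpow_mul, mul_assoc, inv_mul_cancel₀ (hP j).ne', mul_one]
  have hJc : ∑ j ∈ Jᶜ, ((p j).toReal)⁻¹ = 1 - r⁻¹ := by
    have := Finset.sum_add_sum_compl J (fun j => ((p j).toReal)⁻¹)
    rw [← inv_toReal_sum hp Finset.univ, hsum, ← hrJ] at this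
    simp at this
    linarith
  have hWprod : ∀ ω, ∏ j, W j ω = (R ω).toReal ^ (r - 1) := by
    intro ω
    rw [← Finset.prod_mul_prod_compl J, Finset.prod_eq_one (fun j hj => by simp [W, hj]), one_mul]
    rw [Finset.prod_congr rfl (g := fun j => (R ω).toReal ^ (r * ((p j).toReal)⁻¹))
      (fun j hj => by simp [W, Finset.mem_compl.1 hj])]
    rw [← Real.rpow_sum_of_nonneg ENNReal.toReal_nonneg
      (fun j _ => mul_nonneg hr0.le (inv_nonneg.2 (hP j).le)), ← Finset.mul_sum, hJc]
    congr 1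
    field_simp
  let c : Fin (n + 1) → Ω → ℂ := fun j ω => (W j ω : ℂ) * (if j = v then θ ω else 1)
  have hcm' : ∀ j, StronglyMeasurable (c j) := by
    intro j
    refine (Complex.measurable_ofReal.comp (hWm j)).stronglyMeasurable.mul ?_
    split_ifs
    · exact hθm
    · exact stronglyMeasurable_const
  have hcn : ∀ j ω, ‖c j ω‖ ≤ W j ω := by
    intro j ω
    simp only [c, norm_mul, Complex.norm_real, Real.norm_of_nonneg (hW0 j ω)]
    refine mul_le_of_le_one_right (hW0 j ω) ?_
    split_ifs
    · exact hθ1 ω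
    · simp
  have hcJ : ∀ j ∈ J, ∀ ω, c j ω = 1 := by
    intro j hj ω
    have : j ≠ v := fun h => hv (h ▸ hj)
    simp [c, W, hj, this]
  let G : ∀ j, Fin K → Ω → Z j := fun j k ω => c j ω • C j k ω
  have hGm : ∀ j k, StronglyMeasurable (G j k) := fun j k => (hcm' j).smul (hCm j k)
  have hGn : ∀ j, j ∉ J → ∀ k ω, ‖G j k ω‖ₑ ≤ ENNReal.ofReal (W j ω) := by
    intro j hj k ω
    rw [← ofReal_norm]
    refine ENNReal.ofReal_le_ofReal ?_
    simp only [G, norm_smul, C, comb, hj, if_false]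
    exact (mul_le_mul (hcn j ω) ((h (i ω)).2.norm_le j hj k) (norm_nonneg _) (hW0 j ω)).trans_eq
      (mul_one _)
  have hGr : ∀ j, j ∉ J → j ≠ v → ∀ ω, radE (fun k => G j k ω) ≤ ENNReal.ofReal (W j ω) := by
    intro j hj hjv ω
    refine ENNReal.ofReal_le_ofReal ?_
    simp only [G, C, comb, hj, if_false]
    rw [radNorm_smul]
    exact (mul_le_mul (hcn j ω) ((h (i ω)).2.2 j hj hjv) (radNorm_nonneg _) (hW0 j ω)).trans_eq
      (mul_one _)
  have hGL : ∀ j, j ∉ J → ∀ k, MemLp (G j k) (p j) μ := by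
    intro j hj k
    refine ⟨(hGm j k).aestronglyMeasurable, ?_⟩
    rw [eLpNorm_lt_top_iff_lintegral_rpow_enorm_lt_top
      (zero_lt_one.trans (hp j).1).ne' (hp j).2]
    refine lt_of_le_of_lt ?_ hAt
    rw [← hWP j hj]
    exact lintegral_mono fun ω => ENNReal.rpow_le_rpow (hGn j hj k ω) (hP j).le
  let gL : ∀ j, Fin K → Lp (Z j) (p j) μ := fun j k =>
    if hj : j ∈ J then F j k else (hGL j hj k).toLp (G j k)
  have hgL : ∀ᵐ ω ∂μ, ∀ j k, gL j k ω = G j k ω := by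
    rw [ae_all_iff]; intro j
    rw [ae_all_iff]; intro k
    by_cases hj : j ∈ J
    · refine Filter.Eventually.of_forall fun ω => ?_
      simp [gL, hj, G, hcJ j hj, C, comb]
    · simp only [gL, hj, dif_neg, not_false_eq_true]
      exact (hGL j hj k).coeFn_toLp
  let k₀ : Fin K := ⟨0, Nat.pos_of_ne_zero hK⟩
  have hgLv : ∀ k, gL v k = gL v k₀ := by
    intro k
    simp only [gL, hv, dif_neg, not_false_eq_true]
    refine MemLp.toLp_congr _ _ (Filter.Eventually.of_forall fun ω => ?_)
    obtain ⟨⟨gv, h1, -⟩, -⟩ := (h (i ω)).2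
    simp only [G, C, comb, hv, if_false, h1]
  let T : Fin (n + 1) → ℝ≥0∞ := fun j =>
    if j ∈ J then 1 else kahE (p j) * A ^ ((p j).toReal)⁻¹
  have hTt : ∀ j, T j ≠ ⊤ := by
    intro j
    simp only [T]
    split_ifs
    · simp
    · exact ENNReal.mul_ne_top (kahE_ne_top _)
        (ENNReal.rpow_lt_top_of_nonneg (inv_nonneg.2 (hP j).le) hAt.ne).ne
  have hmain := RMfam_hom (Z := fun j => Lp (Z j) (p j) μ) (WW μ p ϖ) (WW_hom hϖ) hv gL (gL v k₀)
    hgLv (fun j => (T j).toReal) (fun j hj => by simp [T, hj])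
    (by
      have : ‖gL v k₀‖ₑ ≤ T v := by
        simp only [T, hv, if_false]
        have h1 : ‖gL v k₀‖ₑ ^ (p v).toReal ≤ A := by
          rw [← lintegral_enorm_Lp (hp v).1 (hp v).2, ← hWP v hv]
          refine lintegral_mono_ae ?_
          filter_upwards [hgL] with ω hω
          rw [hω]
          exact ENNReal.rpow_le_rpow (hGn v hv k₀ ω) (hP v).le
        have h2 := ENNReal.rpow_le_rpow h1 (inv_nonneg.2 (hP v).le)
        rw [ENNReal.rpow_rpow_inv (hP v).ne'] at h2
        exact h2.trans (le_mul_of_one_le_left' (one_le_kahE _))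
      have h3 := ENNReal.toReal_mono (hTt v) this
      simpa using h3)
    (by
      intro j hj hjv
      refine (ENNReal.ofReal_le_iff_le_toReal (hTt j)).1 ?_
      refine (radE_Lp_le (hp j).1 (hp j).2 (gL j)).trans ?_
      simp only [T, hj, if_false]
      gcongr
      rw [← hWP j hj]
      refine lintegral_mono_ae ?_
      filter_upwards [hgL] with ω hω
      simp only [hω]
      exact ENNReal.rpow_le_rpow (hGr j hj hjv ω) (hP j).le)
  have hRMeq : RMfam (Z := fun j => Lp (Z j) (p j) μ) (WW μ p ϖ) J v (fun j _ => gL j) =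
      RMfam (Z := fun j => Lp (Z j) (p j) μ) (WW μ p ϖ) J v (fun j _ => F j) := by
    congr 1
    funext j hj k
    simp [gL, hj]
  rw [hRMeq] at hmain
  have hTprod : ∏ j, ENNReal.ofReal (T j).toReal ≤ cc p * A ^ (1 - r⁻¹) := by
    simp only [ENNReal.ofReal_toReal (hTt _)]
    rw [← Finset.prod_mul_prod_compl J, Finset.prod_eq_one (fun j hj => by simp [T, hj]), one_mul]
    rw [Finset.prod_congr rfl (g := fun j => kahE (p j) * A ^ ((p j).toReal)⁻¹)
      (fun j hj => by simp [T, Finset.mem_compl.1 hj]), Finset.prod_mul_distrib,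
      ennreal_rpow_sum hA0 hAt.ne, hJc]
    gcongr
    exact prod_kahE_le _
  have hint : ∀ k ∈ Finset.univ, Integrable (fun ω => ϖ fun j => gL j k ω) μ :=
    fun k _ => integrable_W hp hsum hϖ (fun j => gL j k)
  have hae : (fun ω => ∑ k, ϖ fun j => gL j k ω) =ᵐ[μ]
      fun ω => (((R ω).toReal ^ (r - 1) * ‖z ω‖ : ℝ) : ℂ) := by
    filter_upwards [hgL] with ω hω
    simp only [hω, G]
    have : ∀ k, ϖ (fun j => c j ω • C j k ω) = (∏ j, c j ω) * ϖ fun j => C j k ω :=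
      fun k => hϖ.hom (fun j => c j ω) _
    simp only [this]
    rw [← Finset.mul_sum]
    simp only [c]
    rw [Finset.prod_mul_distrib, Finset.prod_ite_eq' Finset.univ v, if_pos (Finset.mem_univ v),
      mul_assoc]
    have hz : ∑ k, ϖ (fun j => C j k ω) = z ω := rfl
    rw [hz, hθz, ← Complex.ofReal_prod, hWprod]
    push_cast
    rfl
  have hreal : Integrable (fun ω => (R ω).toReal ^ (r - 1) * ‖z ω‖) μ := by
    have h1 := ((integrable_finsetSum _ hint).congr hae).re
    simpa using h1
  have hval : ‖∑ k, WW μ p ϖ fun j => gL j k‖ₑ =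
      ∫⁻ ω, ENNReal.ofReal ((R ω).toReal ^ (r - 1) * ‖z ω‖) ∂μ := by
    rw [← ofReal_integral_eq_lintegral_ofReal hreal (Filter.Eventually.of_forall fun ω =>
      mul_nonneg (Real.rpow_nonneg ENNReal.toReal_nonneg _) (norm_nonneg _))]
    simp only [WW]
    rw [← integral_finsetSum _ hint, integral_congr_ae hae, integral_complex_ofReal, ← ofReal_norm,
      Complex.norm_real, Real.norm_of_nonneg]
    exact integral_nonneg fun ω =>
      mul_nonneg (Real.rpow_nonneg ENNReal.toReal_nonneg _) (norm_nonneg _)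
  have hlow : A ≤ 2 * ‖∑ k, WW μ p ϖ fun j => gL j k‖ₑ := by
    rw [hval, ← lintegral_const_mul' _ _ (by simp)]
    refine lintegral_mono fun ω => ?_
    have h1 : R ω ^ r = ENNReal.ofReal ((R ω).toReal ^ r) := by
      rw [← ENNReal.ofReal_rpow_of_nonneg ENNReal.toReal_nonneg hr0.le,
        ENNReal.ofReal_toReal (hRt ω).ne]
    have h2 : (2 : ℝ≥0∞) = ENNReal.ofReal 2 := by simp
    simp only
    rw [h1, h2, ← ENNReal.ofReal_mul (by norm_num)]
    refine ENNReal.ofReal_le_ofReal ?_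
    have h3 : (R ω).toReal ^ r = (R ω).toReal ^ (r - 1) * (R ω).toReal := by
      have := Real.rpow_add_of_nonneg (ENNReal.toReal_nonneg (a := R ω))
        (sub_nonneg.2 hr) zero_le_one
      rwa [sub_add_cancel, Real.rpow_one] at this
    rw [h3]
    have h4 := mul_le_mul_of_nonneg_left (hRz ω)
      (Real.rpow_nonneg (ENNReal.toReal_nonneg (a := R ω)) (r - 1))
    linarith
  set B := A ^ (1 - r⁻¹) with hB
  have hB0 : B ≠ 0 := by
    rw [hB]; exact (ENNReal.rpow_pos (pos_iff_ne_zero.2 hA0) hAt.ne).ne'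
  have hBt : B ≠ ⊤ := ENNReal.rpow_ne_top_of_ne_zero hA0 hAt.ne
  have hAB : A = A ^ r⁻¹ * B := by
    rw [hB, ← ENNReal.rpow_add _ _ hA0 hAt.ne]; simp
  refine (ENNReal.mul_le_mul_iff_left hB0 hBt).1 ?_
  rw [← hAB]
  refine hlow.trans ((mul_le_mul_right (hmain.trans (mul_le_mul_right hTprod _)) 2).trans_eq ?_)
  ring

end Lower2

/-- RM constants for Bochner `L^p` tuples: the RM constant of a family of
`L^{p_j}(Ω; X_j)`-valued sequences with respect to the induced contraction
`ϖ(f) = ∫ ϖ₀(f(ω)) dμ(ω)` is comparable to the `L^{p(J)}(Ω)`-norm of the fiberwise RM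
constants. -/
theorem rmConst_lp_tuple {n : ℕ} (hn : 3 ≤ n)
    (p : Fin (n + 1) → ℝ≥0∞) [∀ j, Fact (1 ≤ p j)]
    (hp : ∀ j, 1 < p j ∧ p j ≠ ⊤) (hsum : ∑ j, (p j)⁻¹ = 1) :
    ∃ c : ℝ≥0∞, 0 < c ∧ c ≠ ⊤ ∧
    ∀ (Z : Fin (n + 1) → Type u)
      (_ : ∀ j, NormedAddCommGroup (Z j)) (_ : ∀ j, NormedSpace ℂ (Z j))
      (_ : ∀ j, CompleteSpace (Z j)),
      (∀ j, Function.Surjective (NormedSpace.inclusionInDoubleDual ℂ (Z j))) →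
    ∀ (ϖ₀ : (∀ j, Z j) → ℂ), IsContraction ϖ₀ →
    ∀ (Ω : Type w) (mΩ : MeasurableSpace Ω) (μ : Measure Ω)
      (J : Finset (Fin (n + 1))), 1 ≤ J.card → J.card ≤ n - 2 →
    ∀ v : Fin (n + 1), v ∉ J →
    ∀ f : ∀ j ∈ J, ℕ → Lp (Z j) (p j) μ,
      RMfamInf (Z := fun j => Lp (Z j) (p j) μ)
          (fun g => ∫ ω, ϖ₀ (fun j => (g j : Ω → Z j) ω) ∂μ) J v f ≤
        c * (∫⁻ ω, (RMfamInf ϖ₀ J v fun j hj k => (f j hj k : Ω → Z j) ω) ^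
              ((∑ j ∈ J, (p j)⁻¹)⁻¹).toReal ∂μ) ^ (((∑ j ∈ J, (p j)⁻¹)⁻¹).toReal)⁻¹ ∧
      (∫⁻ ω, (RMfamInf ϖ₀ J v fun j hj k => (f j hj k : Ω → Z j) ω) ^
            ((∑ j ∈ J, (p j)⁻¹)⁻¹).toReal ∂μ) ^ (((∑ j ∈ J, (p j)⁻¹)⁻¹).toReal)⁻¹ ≤
        c * RMfamInf (Z := fun j => Lp (Z j) (p j) μ)
              (fun g => ∫ ω, ϖ₀ (fun j => (g j : Ω → Z j) ω) ∂μ) J v f := by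
  have hP : ∀ j, 0 < (p j).toReal := fun j => by linarith [toReal_gt_one (hp j)]
  refine ⟨2 * cc p, ?_, ENNReal.mul_ne_top (by simp) cc_ne_top, ?_⟩
  · have h1 : 1 ≤ cc p := by simpa using prod_kahE_le (p := p) ∅
    exact ENNReal.mul_pos (by simp) (zero_lt_one.trans_le h1).ne'
  intro Z _ _ _ _ ϖ hϖ Ω mΩ μ J hJ1 hJ2 v hv f
  obtain ⟨F, hF⟩ : ∃ F : ∀ j, ℕ → Lp (Z j) (p j) μ, f = fun j _ => F j :=
    ⟨fun j k => if hj : j ∈ J then f j hj k else 0, by funext j hj k; simp [hj]⟩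
  subst hF
  have hsr : ((∑ j ∈ J, (p j)⁻¹)⁻¹).toReal = (∑ j ∈ J, ((p j).toReal)⁻¹)⁻¹ := by
    rw [ENNReal.toReal_inv, inv_toReal_sum hp]
  generalize hrdef : ((∑ j ∈ J, (p j)⁻¹)⁻¹).toReal = r at *
  have hrJ : r⁻¹ = ∑ j ∈ J, ((p j).toReal)⁻¹ := by rw [hsr, inv_inv]
  have hpos : 0 < ∑ j ∈ J, ((p j).toReal)⁻¹ :=
    Finset.sum_pos (fun j _ => inv_pos.2 (hP j)) (Finset.card_pos.1 hJ1)
  have hle : ∑ j ∈ J, ((p j).toReal)⁻¹ ≤ 1 := by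
    have h1 : ∑ j, ((p j).toReal)⁻¹ = 1 := by rw [← inv_toReal_sum hp, hsum]; simp
    rw [← h1]
    exact Finset.sum_le_sum_of_subset_of_nonneg (Finset.subset_univ J)
      fun j _ _ => inv_nonneg.2 (hP j).le
  have hr1 : 1 ≤ r := by rw [hsr]; exact (one_le_inv₀ hpos).2 hle
  have hr0 : 0 < r := by linarith
  have hri : 0 ≤ r⁻¹ := inv_nonneg.2 hr0.le
  obtain ⟨j₀, hj₀⟩ : ∃ j₀, j₀ ∉ insert v J := by
    by_contra! hcon
    have h1 : (Finset.univ : Finset (Fin (n + 1))) ⊆ insert v J := fun j _ => hcon j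
    have h2 := Finset.card_le_card h1
    have h3 := Finset.card_insert_le v J
    simp at h2
    omega
  have hj0v : j₀ ≠ v := fun h => hj₀ (by simp [h])
  have hj0J : j₀ ∉ J := fun h => hj₀ (by simp [h])
  constructor
  · refine iSup_le fun K => ?_
    refine (upper hp hsum hϖ hv hr0 hrJ (fun j (k : Fin K) => F j k)).trans ?_
    have h1 : cc p ≤ 2 * cc p := le_mul_of_one_le_left' (by norm_num)
    refine mul_le_mul' h1 (ENNReal.rpow_le_rpow (lintegral_mono fun ω => ?_) hri)
    refine ENNReal.rpow_le_rpow ?_ hr0.le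
    exact le_iSup (fun K : ℕ => RMfam ϖ J v fun j _ => fun k : Fin K => (F j k : Ω → Z j) ω) K
  · have hmono : ∀ ω, Monotone fun K : ℕ =>
        RMfam ϖ J v fun j _ => fun k : Fin K => (F j k : Ω → Z j) ω := fun ω =>
      monotone_nat_of_le_succ fun K =>
        RMfam_mono ϖ hϖ.zero hv j₀ hj0J hj0v (fun j k => (F j k : Ω → Z j) ω) K
    have hpow : ∀ ω, (RMfamInf ϖ J v fun j _ k => (F j k : Ω → Z j) ω) ^ r =
        ⨆ K : ℕ, (RMfam ϖ J v fun j _ => fun k : Fin K => (F j k : Ω → Z j) ω) ^ r := by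
      intro ω
      exact (ENNReal.orderIsoRpow r hr0).map_iSup _
    simp only [hpow]
    rw [lintegral_iSup]
    · have hsup : ∀ a : ℕ → ℝ≥0∞, (⨆ K, a K) ^ r⁻¹ = ⨆ K, a K ^ r⁻¹ := fun a =>
        (ENNReal.orderIsoRpow r⁻¹ (inv_pos.2 hr0)).map_iSup _
      rw [hsup]
      refine iSup_le fun K => ?_
      refine (lower hp hsum hϖ hv hr1 hrJ (fun j (k : Fin K) => F j k)).trans ?_
      refine mul_le_mul' le_rfl ?_
      exact le_iSup (fun K : ℕ => RMfam (Z := fun j => Lp (Z j) (p j) μ) (WW μ p ϖ) J v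
        fun j _ => fun k : Fin K => F j k) K
    · intro K
      exact (measurable_RM hϖ.continuous hv (fun j (k : Fin K) => F j k)
        (fun j k => Lp.stronglyMeasurable (F j k))).pow_const r
    · intro K K' hKK ω
      exact ENNReal.rpow_le_rpow (hmono ω hKK) hr0.le


end OVM
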